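/- There exist constants C > 0 and c > 0 such that for every ε > 0 there exists n₀ with the following property. For all n ≥ n₀ and all integers d with log^{10} n ≤ d ≤ n/C and nd even, setting p = d/n: with probability at least 1 − ε over G ∼ G_d(n), the n×n symmetric matrix M(G) with entries M(G)[i,j] = χ_{{i,j}}(G) for i ≠ j and M(G)[i,i] = 0 satisfies ‖M(G)‖ ≤ C · √n · log^c n, where ‖·‖ is the spectral norm. (Equivalently, the centered rescaled adjacency matrix of a uniformly random d-regular graph, i.e. (A_G − p(J−I))/√(p(1−p)) off the diagonal, has spectral norm at most √n times a polylogarithmic factor with high probability.) -/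

import Mathlib

open scoped Classical

noncomputable section

namespace GM

/-- A graph on vertex set `Fin n`, given as a finite set of (potential) edges. -/
abbrev Graph (n : ℕ) := Finset (Sym2 (Fin n))

/-- The edge set contains no self-loops. -/
def IsSimpleG {n : ℕ} (G : Graph n) : Prop := ∀ e ∈ G, ¬ e.IsDiag

/-- Degree of a vertex. -/
def degree {n : ℕ} (G : Graph n) (v : Fin n) : ℕ := (G.filter (fun e => v ∈ e)).card

/-- The set of simple `d`-regular graphs on `n` vertices. -/
def regularGraphs (n d : ℕ) : Finset (Graph n) :=
  Finset.univ.filter (fun G => IsSimpleG G ∧ ∀ v, degree G v = d)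

/-- Expectation of `f` under the uniform distribution on `d`-regular graphs. -/
def regExp (n d : ℕ) (f : Graph n → ℝ) : ℝ :=
  (∑ G ∈ regularGraphs n d, f G) / (regularGraphs n d).card

/-- Probability of `P` under the uniform distribution on `d`-regular graphs. -/
def regPr (n d : ℕ) (P : Graph n → Prop) : ℝ :=
  (((regularGraphs n d).filter P).card : ℝ) / (regularGraphs n d).card

/-- The `p`-biased edge character. -/
def char {n : ℕ} (p : ℝ) (G : Graph n) (e : Sym2 (Fin n)) : ℝ :=
  if e ∈ G then Real.sqrt ((1 - p) / p) else - Real.sqrt (p / (1 - p))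

/-- A shape: a simple graph on `Fin m` with ordered tuples of distinct boundary vertices. -/
structure Shape where
  m : ℕ
  edges : Finset (Sym2 (Fin m))
  simple : ∀ e ∈ edges, ¬ e.IsDiag
  a : ℕ
  b : ℕ
  U : Fin a → Fin m
  V : Fin b → Fin m
  injU : Function.Injective U
  injV : Function.Injective V

/-- The simple graph underlying a shape. -/
def Shape.graph (τ : Shape) : SimpleGraph (Fin τ.m) :=
  SimpleGraph.fromEdgeSet (τ.edges : Set (Sym2 (Fin τ.m)))

/-- The boundary vertices of a shape. -/
def Shape.boundary (τ : Shape) : Finset (Fin τ.m) :=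
  Finset.univ.image τ.U ∪ Finset.univ.image τ.V

/-- The graph matrix of a shape, evaluated on a graph `G` with `p`-biased characters. -/
def graphMatrix (τ : Shape) (n : ℕ) (p : ℝ) (G : Graph n) :
    Matrix (Fin τ.a → Fin n) (Fin τ.b → Fin n) ℝ :=
  Matrix.of fun A B =>
    ∑ ψ ∈ Finset.univ.filter (fun ψ : Fin τ.m → Fin n =>
        Function.Injective ψ ∧ (∀ i, ψ (τ.U i) = A i) ∧ (∀ j, ψ (τ.V j) = B j)),
      ∏ e ∈ τ.edges, char p G (e.map ψ)

/-- `S` is a vertex separator of the shape `τ`: every path from the left boundary to the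
right boundary contains a vertex of `S`. -/
def IsSeparator (τ : Shape) (S : Finset (Fin τ.m)) : Prop :=
  ∀ (i : Fin τ.a) (j : Fin τ.b) (w : τ.graph.Walk (τ.U i) (τ.V j)),
    w.IsPath → ∃ v ∈ w.support, v ∈ S

/-- The set of edges of `τ` with both endpoints in `S`. -/
def edgesIn (τ : Shape) (S : Finset (Fin τ.m)) : Finset (Sym2 (Fin τ.m)) :=
  τ.edges.filter (fun e => ∀ v ∈ e, v ∈ S)

/-- Isolated vertices: vertices outside the boundary incident to no edge. -/
def isolatedVerts (τ : Shape) : Finset (Fin τ.m) :=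
  Finset.univ.filter (fun v => v ∉ τ.boundary ∧ ∀ e ∈ τ.edges, v ∉ e)

/-- `C` is the vertex set of a connected component of `τ`. -/
def IsComponent (τ : Shape) (C : Finset (Fin τ.m)) : Prop :=
  ∃ v, C = Finset.univ.filter (fun w => τ.graph.Reachable v w)

/-- `C` is a floating component of `τ`: an edge-induced connected component with no path
to the boundary. -/
def IsFloating (τ : Shape) (C : Finset (Fin τ.m)) : Prop :=
  IsComponent τ C ∧ (∃ e ∈ τ.edges, ∀ v ∈ e, v ∈ C) ∧
    ∀ v ∈ C, ∀ w ∈ τ.boundary, ¬ τ.graph.Reachable v w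

/-- A component is tree-like if `|V(C)| = |E(C)| + 1`. -/
def TreeLike (τ : Shape) (C : Finset (Fin τ.m)) : Prop :=
  C.card = (edgesIn τ C).card + 1

/-- The number of tree-like floating components of `τ` having no path to `S`. -/
def floatTreeCount (τ : Shape) (S : Finset (Fin τ.m)) : ℕ :=
  (Finset.univ.filter (fun C : Finset (Fin τ.m) =>
    IsFloating τ C ∧ TreeLike τ C ∧ ∀ v ∈ C, ∀ s ∈ S, ¬ τ.graph.Reachable v s)).card

/-- The block-value bound `B_q(τ)` (version with floating-component factor). -/
def Bq (τ : Shape) (n q : ℕ) (p cnorm : ℝ) : ℝ :=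
  sSup { x : ℝ | ∃ S : Finset (Fin τ.m), IsSeparator τ S ∧
    x = (Real.sqrt n * q) ^ (Finset.univ \ S).card
        * Real.sqrt ((1 - p) / p) ^ (edgesIn τ S).card
        * Real.sqrt n ^ (isolatedVerts τ).card
        * Real.sqrt n ^ floatTreeCount τ S
        * cnorm ^ τ.edges.card }

/-- The block-value bound `B_q(τ)` (version without floating-component factor). -/
def Bq0 (τ : Shape) (n q : ℕ) (p cnorm : ℝ) : ℝ :=
  sSup { x : ℝ | ∃ S : Finset (Fin τ.m), IsSeparator τ S ∧
    x = (Real.sqrt n * q) ^ (Finset.univ \ S).card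
        * Real.sqrt ((1 - p) / p) ^ (edgesIn τ S).card
        * Real.sqrt n ^ (isolatedVerts τ).card
        * cnorm ^ τ.edges.card }

/-- The spectral norm (ℓ₂→ℓ₂ operator norm) of a rectangular real matrix. -/
def specNorm {α β : Type*} [Fintype α] [Fintype β] [DecidableEq α] [DecidableEq β]
    (M : Matrix α β ℝ) : ℝ :=
  ‖LinearMap.toContinuousLinearMap (Matrix.toEuclideanLin M)‖

end GM

namespace GM

/-- The set of all non-loop pairs. -/
def allE (n : ℕ) : Finset (Sym2 (Fin n)) := Finset.univ.filter (fun e => ¬ e.IsDiag)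

/-- neighbours -/
def nb {n : ℕ} (G : Graph n) (v : Fin n) : Finset (Fin n) :=
  Finset.univ.filter (fun w => s(v, w) ∈ G)

lemma mem_nb {n : ℕ} {G : Graph n} {v w : Fin n} : w ∈ nb G v ↔ s(v, w) ∈ G := by
  simp [nb]

lemma degree_eq {n : ℕ} (G : Graph n) (v : Fin n) : degree G v = (nb G v).card := by
  unfold degree
  have : G.filter (fun e => v ∈ e) = (nb G v).image (fun w => s(v, w)) := by
    ext e
    simp only [Finset.mem_filter, Finset.mem_image, mem_nb]
    constructor
    · rintro ⟨he, w, rfl⟩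
      exact ⟨w, he, rfl⟩
    · rintro ⟨w, hw, rfl⟩
      exact ⟨hw, by simp⟩
  rw [this, Finset.card_image_of_injective]
  intro a b h
  have h' : a = b ∨ v = b ∧ a = v := by simpa using h
  rcases h' with h' | h'
  · exact h'
  · rw [h'.2, h'.1]

lemma degree_insert {n : ℕ} (G : Graph n) (e : Sym2 (Fin n)) (he : e ∉ G) (x : Fin n) :
    degree (insert e G) x = degree G x + if x ∈ e then 1 else 0 := by
  unfold degree
  rw [Finset.filter_insert]
  split_ifs with h
  · rw [Finset.card_insert_of_notMem]
    simp [he]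
  · simp

lemma degree_erase {n : ℕ} (G : Graph n) (e : Sym2 (Fin n)) (he : e ∈ G) (x : Fin n) :
    degree (G.erase e) x + (if x ∈ e then 1 else 0) = degree G x := by
  rw [← degree_insert _ _ (Finset.notMem_erase e G), Finset.insert_erase he]

/-- Graphs with a given degree sequence. -/
def degSet (n : ℕ) (D : Fin n → ℕ) : Finset (Graph n) :=
  Finset.univ.filter (fun G => IsSimpleG G ∧ ∀ v, degree G v = D v)

lemma mem_degSet {n : ℕ} {D : Fin n → ℕ} {G : Graph n} :
    G ∈ degSet n D ↔ IsSimpleG G ∧ ∀ v, degree G v = D v := by simp [degSet]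

/-- exclusive neighbours of `u` relative to `v` -/
def pn {n : ℕ} (G : Graph n) (u v : Fin n) : Finset (Fin n) :=
  Finset.univ.filter (fun w => w ≠ v ∧ s(u, w) ∈ G ∧ s(v, w) ∉ G)

lemma mem_pn {n : ℕ} {G : Graph n} {u v w : Fin n} :
    w ∈ pn G u v ↔ w ≠ v ∧ s(u, w) ∈ G ∧ s(v, w) ∉ G := by simp [pn]

lemma no_loop {n : ℕ} {G : Graph n} (hG : IsSimpleG G) (v : Fin n) : s(v, v) ∉ G := by
  intro h
  exact hG _ h (by simp)

lemma degree_eq_pn {n : ℕ} {G : Graph n} (hG : IsSimpleG G) (u v : Fin n) :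
    degree G u = (pn G u v).card + (if s(u, v) ∈ G then 1 else 0)
      + (Finset.univ.filter (fun w => s(u, w) ∈ G ∧ s(v, w) ∈ G)).card := by
  rw [degree_eq]
  have h1 : nb G u = ((pn G u v) ∪ (if s(u, v) ∈ G then {v} else ∅)) ∪
      (Finset.univ.filter (fun w => s(u, w) ∈ G ∧ s(v, w) ∈ G)) := by
    ext w
    have := no_loop hG v
    by_cases hw : w = v
    · subst hw
      split_ifs <;> simp_all [mem_nb, mem_pn]
    · split_ifs <;> simp_all [mem_nb, mem_pn] <;> tauto
  rw [h1, Finset.card_union_of_disjoint, Finset.card_union_of_disjoint]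
  · congr 2
    split_ifs <;> simp
  · rw [Finset.disjoint_left]
    intro a ha
    rw [mem_pn] at ha
    split_ifs <;> simp [ha.1]
  · rw [Finset.disjoint_left]
    intro a ha
    have := no_loop hG v
    simp only [Finset.mem_union, mem_pn] at ha
    simp only [Finset.mem_filter]
    rintro ⟨_, h2, h3⟩
    rcases ha with ha | ha
    · exact ha.2.2 h3
    · split_ifs at ha
      · simp at ha; subst ha; exact this h3
      · simp at ha

lemma pn_diff {n : ℕ} {G : Graph n} (hG : IsSimpleG G) (u v : Fin n) :
    degree G u + (pn G v u).card = degree G v + (pn G u v).card := by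
  rw [degree_eq_pn hG u v, degree_eq_pn hG v u]
  have : (Finset.univ.filter (fun w => s(u, w) ∈ G ∧ s(v, w) ∈ G)) =
    (Finset.univ.filter (fun w => s(v, w) ∈ G ∧ s(u, w) ∈ G)) := by
    ext w; simp [and_comm]
  rw [this, Sym2.eq_swap (a := u) (b := v)]
  ring

/-- move edge `uw` to `vw`. -/
def mv {n : ℕ} (G : Graph n) (u v w : Fin n) : Graph n := insert s(v, w) (G.erase s(u, w))

lemma mv_simple {n : ℕ} {G : Graph n} (hG : IsSimpleG G) {u v w : Fin n} (hw : w ≠ v) :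
    IsSimpleG (mv G u v w) := by
  intro e he
  rcases Finset.mem_insert.1 he with rfl | h
  · simpa using hw.symm
  · exact hG e (Finset.mem_of_mem_erase h)

lemma mv_degree {n : ℕ} {G : Graph n} {u v w : Fin n} (hw : w ∈ pn G u v) (huv : u ≠ v)
    (hG : IsSimpleG G) (x : Fin n) :
    degree (mv G u v w) x + (if x = u then 1 else 0) = degree G x + (if x = v then 1 else 0) := by
  rw [mem_pn] at hw
  obtain ⟨h1, h2, h3⟩ := hw
  have hwu : w ≠ u := by rintro rfl; exact no_loop hG _ h2
  have := degree_erase G _ h2 x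
  unfold mv
  rw [degree_insert _ _ (by simp [h3])]
  simp only [Sym2.mem_iff] at *
  by_cases hx : x = u <;> by_cases hx' : x = v <;> by_cases hx'' : x = w <;> simp_all

lemma mv_back {n : ℕ} {G : Graph n} {u v w : Fin n} (hw : w ∈ pn G u v) (huv : u ≠ v) :
    mv (mv G u v w) v u w = G := by
  rw [mem_pn] at hw
  obtain ⟨h1, h2, h3⟩ := hw
  unfold mv
  rw [Finset.erase_insert (by simp [h3]), Finset.insert_erase h2]

lemma mv_pn {n : ℕ} {G : Graph n} {u v w : Fin n} (hw : w ∈ pn G u v) (huv : u ≠ v)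
    (hG : IsSimpleG G) : w ∈ pn (mv G u v w) v u := by
  have := mem_pn.1 hw
  obtain ⟨h1, h2, h3⟩ := this
  have hwu : w ≠ u := by rintro rfl; exact no_loop hG _ h2
  rw [mem_pn]
  refine ⟨hwu, by simp [mv], ?_⟩
  simp [mv, huv, h1]

lemma mv_pn_sub {n : ℕ} {G : Graph n} {u v w : Fin n} (hw : w ∈ pn G u v) (huv : u ≠ v)
    (hG : IsSimpleG G) : pn (mv G u v w) u v ⊆ pn G u v := by
  obtain ⟨h1, h2, h3⟩ := mem_pn.1 hw
  intro x hx
  rw [mem_pn] at *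
  obtain ⟨g1, g2, g3⟩ := hx
  refine ⟨g1, ?_, ?_⟩
  · simp only [mv, Finset.mem_insert, Finset.mem_erase] at g2
    rcases g2 with g2 | g2
    · rw [Sym2.eq_iff] at g2
      rcases g2 with g2 | g2
      · exact absurd g2.1 huv
      · exact absurd g2.2 g1
    · exact g2.2
  · intro h
    apply g3
    simp only [mv, Finset.mem_insert, Finset.mem_erase]
    right
    refine ⟨?_, h⟩
    intro h'
    rw [Sym2.eq_iff] at h'
    rcases h' with h' | h'
    · exact huv h'.1.symm
    · exact h1 h'.1.symm

lemma degSet_step {n : ℕ} (D D' : Fin n → ℕ) (u v : Fin n) (huv : D v + 2 ≤ D u)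
    (hD : ∀ x, D' x + (if x = u then 1 else 0) = D x + (if x = v then 1 else 0)) :
    (degSet n D).card ≤ (degSet n D').card := by
  have huv' : u ≠ v := by rintro rfl; omega
  have hu := hD u
  have hv := hD v
  simp [huv', huv'.symm] at hu hv
  have key : ∑ p ∈ (degSet n D).sigma (fun G => pn G u v), (1 : ℚ) / (pn p.1 u v).card
      = ∑ p ∈ (degSet n D').sigma (fun G => pn G v u), (1 : ℚ) / (pn (mv p.1 v u p.2) u v).card := by
    refine Finset.sum_bij' (fun p _ => ⟨mv p.1 u v p.2, p.2⟩) (fun p _ => ⟨mv p.1 v u p.2, p.2⟩)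
      ?_ ?_ ?_ ?_ ?_
    · rintro ⟨G, w⟩ h
      simp only [Finset.mem_sigma, mem_degSet] at h ⊢
      obtain ⟨⟨h1, h2⟩, h3⟩ := h
      refine ⟨⟨mv_simple h1 (mem_pn.1 h3).1, fun x => ?_⟩, mv_pn h3 huv' h1⟩
      have := mv_degree h3 huv' h1 x
      have := hD x
      have := h2 x
      omega
    · rintro ⟨G, w⟩ h
      simp only [Finset.mem_sigma, mem_degSet] at h ⊢
      obtain ⟨⟨h1, h2⟩, h3⟩ := h
      refine ⟨⟨mv_simple h1 (mem_pn.1 h3).1, fun x => ?_⟩, mv_pn h3 huv'.symm h1⟩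
      have := mv_degree h3 huv'.symm h1 x
      have := hD x
      have := h2 x
      omega
    · rintro ⟨G, w⟩ h
      simp only [Finset.mem_sigma, mem_degSet] at h
      simp [mv_back h.2 huv']
    · rintro ⟨G, w⟩ h
      simp only [Finset.mem_sigma, mem_degSet] at h
      simp [mv_back h.2 huv'.symm]
    · rintro ⟨G, w⟩ h
      simp only [Finset.mem_sigma, mem_degSet] at h
      simp [mv_back h.2 huv']
  rw [Finset.sum_sigma, Finset.sum_sigma] at key
  have h1 : ∑ G ∈ degSet n D, ∑ w ∈ pn G u v, (1 : ℚ) / (pn G u v).card = (degSet n D).card := by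
    rw [Finset.card_eq_sum_ones, Nat.cast_sum]
    apply Finset.sum_congr rfl
    intro G hG
    rw [mem_degSet] at hG
    have := pn_diff hG.1 u v
    rw [hG.2, hG.2] at this
    have h0 : ((pn G u v).card : ℚ) ≠ 0 := by
      have : (pn G u v).card ≠ 0 := by omega
      exact_mod_cast this
    rw [Finset.sum_const, nsmul_eq_mul]
    field_simp
    simp
  have h2 : ∑ G ∈ degSet n D', ∑ w ∈ pn G v u, (1 : ℚ) / (pn (mv G v u w) u v).card
      ≤ (degSet n D').card := by
    rw [Finset.card_eq_sum_ones, Nat.cast_sum]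
    apply Finset.sum_le_sum
    intro G hG
    rw [mem_degSet] at hG
    by_cases h0 : (pn G v u).card = 0
    · rw [Finset.card_eq_zero] at h0
      simp [h0]
    have hb : ∀ w ∈ pn G v u, (1 : ℚ) / (pn (mv G v u w) u v).card ≤ 1 / (pn G v u).card := by
      intro w hw
      have e1 := mv_pn_sub (mv_pn hw huv'.symm hG.1) huv' (mv_simple hG.1 (mem_pn.1 hw).1)
      rw [mv_back hw huv'.symm] at e1
      have e1 := Finset.card_le_card e1
      have := pn_diff hG.1 u v
      rw [hG.2, hG.2] at this
      have : (pn G v u).card ≤ (pn (mv G v u w) u v).card := by omega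
      apply one_div_le_one_div_of_le
      · exact_mod_cast Nat.pos_of_ne_zero h0
      · exact_mod_cast this
    refine (Finset.sum_le_sum hb).trans ?_
    rw [Finset.sum_const, nsmul_eq_mul]
    have : ((pn G v u).card : ℚ) ≠ 0 := by exact_mod_cast h0
    field_simp
    simp
  have h3 : ((degSet n D).card : ℚ) ≤ (degSet n D').card := by
    rw [← h1, key]; exact h2
  exact_mod_cast h3

lemma degSet_le {n : ℕ} (d k : ℕ) : ∀ D : Fin n → ℕ, ∑ i, D i = n * d → ∑ i, (D i - d) = k →
    (degSet n D).card ≤ (regularGraphs n d).card := by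
  induction k using Nat.strong_induction_on with
  | _ k ih =>
  intro D hs hk
  have hsd : ∑ i : Fin n, d = n * d := by simp
  by_cases hc : ∀ i, D i = d
  · have : degSet n D = regularGraphs n d := by
      ext G; simp [degSet, regularGraphs, hc]
    rw [this]
  have hu : ∃ u, d < D u := by
    by_contra! h
    apply hc
    intro i
    have := (Finset.sum_eq_sum_iff_of_le (fun i (_ : i ∈ Finset.univ) => h i)).1 (by rw [hs, hsd])
    exact this i (Finset.mem_univ _)
  have hv : ∃ v, D v < d := by
    by_contra! h
    apply hc
    intro i
    have := (Finset.sum_eq_sum_iff_of_le (fun i (_ : i ∈ Finset.univ) => h i)).1 (by rw [hs, hsd])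
    exact (this i (Finset.mem_univ _)).symm
  obtain ⟨u, hu⟩ := hu
  obtain ⟨v, hv⟩ := hv
  have huv : u ≠ v := by rintro rfl; omega
  set D' : Fin n → ℕ := fun x => D x + (if x = v then 1 else 0) - (if x = u then 1 else 0) with hD'
  have hD : ∀ x, D' x + (if x = u then 1 else 0) = D x + (if x = v then 1 else 0) := by
    intro x
    simp only [hD']
    by_cases hx : x = u
    · subst hx; simp; omega
    · simp [hx]
  refine (degSet_step D D' u v (by omega) hD).trans ?_
  have hs' : ∑ i, D' i = n * d := by
    have : ∑ x, (D' x + (if x = u then 1 else 0)) = ∑ x, (D x + (if x = v then 1 else 0)) :=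
      Finset.sum_congr rfl (fun x _ => hD x)
    rw [Finset.sum_add_distrib, Finset.sum_add_distrib] at this
    simp at this
    omega
  refine ih (∑ i, (D' i - d)) ?_ D' hs' rfl
  rw [← hk]
  apply Finset.sum_lt_sum
  · intro i _
    have := hD i
    by_cases hx : i = u
    · subst hx; simp [huv] at this; omega
    · by_cases hx' : i = v
      · subst hx'; simp [hx] at this; omega
      · simp [hx, hx'] at this; omega
  · refine ⟨u, Finset.mem_univ _, ?_⟩
    have := hD u
    simp [huv] at this; omega

lemma simple_iff {n : ℕ} (G : Graph n) : IsSimpleG G ↔ G ⊆ allE n := by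
  constructor
  · intro h e he
    simp [allE, h e he]
  · intro h e he
    have := h he
    simpa [allE] using this

lemma handshake {n : ℕ} {G : Graph n} (hG : IsSimpleG G) : ∑ v, degree G v = 2 * G.card := by
  unfold degree
  simp_rw [Finset.card_filter]
  rw [Finset.sum_comm]
  have : ∀ e ∈ G, ∑ v : Fin n, (if v ∈ e then 1 else 0) = 2 := by
    intro e he
    have hd := hG e he
    induction e using Sym2.ind with
    | _ a b =>
    rw [← Finset.card_filter]
    have hab : a ≠ b := by simpa using hd
    have : (Finset.univ.filter (fun v => v ∈ s(a, b))) = {a, b} := by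
      ext x; simp
    rw [this, Finset.card_pair hab]
  rw [Finset.sum_congr rfl this]
  simp [mul_comm]

lemma degree_lt {n : ℕ} {G : Graph n} (hG : IsSimpleG G) (v : Fin n) : degree G v < n := by
  rw [degree_eq]
  have : nb G v ⊂ Finset.univ := by
    rw [Finset.ssubset_univ_iff]
    intro h
    have : v ∈ nb G v := by rw [h]; simp
    exact no_loop hG v (mem_nb.1 this)
  simpa using Finset.card_lt_card this

lemma enum_bound {n d M : ℕ} (h : n * d = 2 * M) :
    ((allE n).card.choose M) ≤ n ^ n * (regularGraphs n d).card := by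
  rw [← Finset.card_powersetCard]
  have : (allE n).powersetCard M ⊆
      (Finset.univ : Finset (Fin n → Fin n)).biUnion (fun D =>
        if ∑ i, (D i : ℕ) = n * d then degSet n (fun i => D i) else ∅) := by
    intro G hG
    rw [Finset.mem_powersetCard, ← simple_iff] at hG
    rw [Finset.mem_biUnion]
    refine ⟨fun v => ⟨degree G v, degree_lt hG.1 v⟩, Finset.mem_univ _, ?_⟩
    have := handshake hG.1
    simp only
    rw [if_pos (by rw [this, h, hG.2]), mem_degSet]
    exact ⟨hG.1, fun _ => rfl⟩
  refine (Finset.card_le_card this).trans ?_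
  refine (Finset.card_biUnion_le_card_mul _ _ (regularGraphs n d).card ?_).trans ?_
  · intro D _
    split_ifs with h
    · exact degSet_le d _ _ h rfl
    · simp
  · simp

end GM
namespace GM

lemma mode_bound (N M : ℕ) (hM : M ≤ N) :
    N ^ N ≤ (N + 1) * (N.choose M * M ^ M * (N - M) ^ (N - M)) := by
  obtain ⟨R, rfl⟩ := Nat.exists_eq_add_of_le hM
  simp only [Nat.add_sub_cancel_left]
  set N := M + R with hN
  set t : ℕ → ℕ := fun k => M ^ k * R ^ (N - k) * N.choose k with ht
  have hchoose : ∀ k, N.choose (k + 1) * (k + 1) = N.choose k * (N - k) :=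
    fun k => Nat.choose_succ_right_eq N k
  have hstep : ∀ k, k < N → t (k + 1) * ((k + 1) * R) = t k * ((N - k) * M) := by
    intro k hk
    simp only [ht]
    have e : N - k = (N - (k + 1)) + 1 := by omega
    have h1 := hchoose k
    calc M ^ (k + 1) * R ^ (N - (k + 1)) * N.choose (k + 1) * ((k + 1) * R)
        = M ^ (k + 1) * R ^ (N - (k + 1) + 1) * (N.choose (k + 1) * (k + 1)) := by ring
      _ = M ^ (k + 1) * R ^ (N - k) * (N.choose k * (N - k)) := by rw [h1, ← e]
      _ = _ := by ring
  have hup : ∀ k, k < M → t k ≤ t (k + 1) := by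
    intro k hk
    have h1 := hstep k (by omega)
    have h2 : (k + 1) * R ≤ (N - k) * M := by
      calc (k + 1) * R ≤ M * (N - k) := Nat.mul_le_mul (by omega) (by omega)
        _ = _ := by ring
    have h3 : 0 < (N - k) * M := Nat.mul_pos (by omega) (by omega)
    have : t k * ((N - k) * M) ≤ t (k + 1) * ((N - k) * M) := by
      rw [← h1]; exact Nat.mul_le_mul_left _ h2
    exact Nat.le_of_mul_le_mul_right this h3
  have hdown : ∀ k, M ≤ k → k < N → t (k + 1) ≤ t k := by
    intro k hk hkN
    have h1 := hstep k (by omega)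
    have h2 : (N - k) * M ≤ (k + 1) * R := by
      calc (N - k) * M ≤ R * (k + 1) := Nat.mul_le_mul (by omega) (by omega)
        _ = _ := by ring
    have h3 : 0 < (k + 1) * R := Nat.mul_pos (by omega) (by omega)
    have : t (k + 1) * ((k + 1) * R) ≤ t k * ((k + 1) * R) := by
      rw [h1]; exact Nat.mul_le_mul_left _ h2
    exact Nat.le_of_mul_le_mul_right this h3
  have hup' : ∀ j, j ≤ M → t (M - j) ≤ t M := by
    intro j
    induction j with
    | zero => simp
    | succ j ih =>
      intro hj
      have := hup (M - (j + 1)) (by omega)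
      have e : M - (j + 1) + 1 = M - j := by omega
      rw [e] at this
      exact this.trans (ih (by omega))
  have hdown' : ∀ j, j ≤ R → t (M + j) ≤ t M := by
    intro j
    induction j with
    | zero => simp
    | succ j ih =>
      intro hj
      have := hdown (M + j) (by omega) (by omega)
      exact this.trans (ih (by omega))
  have hall : ∀ k ∈ Finset.range (N + 1), t k ≤ t M := by
    intro k hk
    rw [Finset.mem_range] at hk
    by_cases h : k ≤ M
    · have := hup' (M - k) (by omega)
      rwa [Nat.sub_sub_self h] at this
    · have := hdown' (k - M) (by omega)
      rwa [show M + (k - M) = k by omega] at this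
  have hsum : N ^ N = ∑ k ∈ Finset.range (N + 1), t k := by
    conv_lhs => rw [hN]
    rw [add_pow]
    simp only [Nat.cast_id]
    rfl
  rw [hsum]
  refine (Finset.sum_le_card_nsmul _ _ _ hall).trans ?_
  simp only [Finset.card_range, smul_eq_mul, ht]
  rw [show N - M = R by omega]
  apply le_of_eq; ring

lemma mode_bound_real (N M : ℕ) (hM : M ≤ N) (hN : 0 < N) (p : ℝ) (hp : p = (M : ℝ) / N) :
    1 ≤ ((N : ℝ) + 1) * (N.choose M * (p ^ M * (1 - p) ^ (N - M))) := by
  have h := mode_bound N M hM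
  have h' : ((N : ℝ)) ^ N ≤ (N + 1) * (N.choose M * M ^ M * ((N : ℝ) - M) ^ (N - M)) := by
    have : ((N ^ N : ℕ) : ℝ) ≤ ((N + 1) * (N.choose M * M ^ M * (N - M) ^ (N - M)) : ℕ) := by
      exact_mod_cast h
    push_cast [Nat.cast_sub hM] at this
    exact this
  have hN' : (0 : ℝ) < N := by exact_mod_cast hN
  have e1 : 1 - p = ((N : ℝ) - M) / N := by rw [hp]; field_simp
  have e2 : (N : ℝ) ^ N = (N : ℝ) ^ M * (N : ℝ) ^ (N - M) := by
    rw [← pow_add]; congr 1; omega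
  rw [e1, hp, div_pow, div_pow]
  have : ((N : ℝ) + 1) * (N.choose M * ((M : ℝ) ^ M / N ^ M * (((N : ℝ) - M) ^ (N - M) / N ^ (N - M))))
    = ((N + 1) * (N.choose M * M ^ M * ((N : ℝ) - M) ^ (N - M))) / N ^ N := by
    rw [e2]; field_simp
  rw [this, le_div_iff₀ (by positivity), one_mul]
  exact h'

lemma mgf_bound {α : Type*} [DecidableEq α] (E : Finset α) (M : ℕ) (p : ℝ) (hp : 0 ≤ p)
    (hp1 : p ≤ 1) (x : α → ℝ) (hx : ∀ e ∈ E, |x e| ≤ 1) :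
    (∑ G ∈ E.powersetCard M, Real.exp (∑ e ∈ G, x e)) * (p ^ M * (1 - p) ^ (E.card - M))
      ≤ Real.exp (p * (∑ e ∈ E, x e) + p * ∑ e ∈ E, x e ^ 2) := by
  have h1 : (∑ G ∈ E.powersetCard M, Real.exp (∑ e ∈ G, x e)) * (p ^ M * (1 - p) ^ (E.card - M))
      ≤ ∏ e ∈ E, (p * Real.exp (x e) + (1 - p)) := by
    rw [Finset.prod_add, Finset.sum_mul]
    have : ∀ G ∈ E.powersetCard M, Real.exp (∑ e ∈ G, x e) * (p ^ M * (1 - p) ^ (E.card - M))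
      = (∏ e ∈ G, p * Real.exp (x e)) * ∏ e ∈ E \ G, (1 - p) := by
      intro G hG
      rw [Finset.mem_powersetCard] at hG
      rw [Finset.prod_mul_distrib, Finset.prod_const, Finset.prod_const, Real.exp_sum,
        Finset.card_sdiff_of_subset hG.1, hG.2]
      ring
    rw [Finset.sum_congr rfl this]
    apply Finset.sum_le_sum_of_subset_of_nonneg
    · intro G hG
      rw [Finset.mem_powersetCard] at hG
      rw [Finset.mem_powerset]; exact hG.1
    · intro G _ _
      apply mul_nonneg
      · exact Finset.prod_nonneg (fun e _ => mul_nonneg hp (Real.exp_pos _).le)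
      · exact Finset.prod_nonneg (fun e _ => by linarith)
  refine h1.trans ?_
  rw [Finset.mul_sum, Finset.mul_sum, ← Finset.sum_add_distrib, Real.exp_sum]
  apply Finset.prod_le_prod
  · intro e _
    have := mul_nonneg hp (Real.exp_pos (x e)).le
    linarith
  · intro e he
    have h2 := (abs_le.1 (Real.abs_exp_sub_one_sub_id_le (hx e he))).2
    have h3 := Real.add_one_le_exp (p * x e + p * x e ^ 2)
    nlinarith

end GM
namespace GM

/-- ordered adjacent pairs -/
def opairs {n : ℕ} (G : Graph n) : Finset (Fin n × Fin n) :=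
  Finset.univ.filter (fun q => s(q.1, q.2) ∈ G)

lemma card_opairs {n : ℕ} {G : Graph n} (hG : IsSimpleG G) : (opairs G).card = 2 * G.card := by
  rw [← handshake hG]
  simp_rw [degree_eq]
  rw [← Finset.card_sigma]
  refine Finset.card_bij' (fun q _ => ⟨q.1, q.2⟩) (fun q _ => (q.1, q.2)) ?_ ?_ ?_ ?_
  · intro q hq; simpa [opairs, mem_nb] using hq
  · intro q hq; simpa [opairs, mem_nb] using hq
  · intro q hq; rfl
  · intro q hq; rfl

lemma mem_reg {n d : ℕ} {G : Graph n} :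
    G ∈ regularGraphs n d ↔ IsSimpleG G ∧ ∀ v, degree G v = d := by simp [regularGraphs]

/-- good switching partners -/
def swX {n : ℕ} (H G : Graph n) (u v : Fin n) : Finset (Fin n × Fin n) :=
  Finset.univ.filter (fun q => s(q.1, q.2) ∈ G ∧ s(q.1, q.2) ∉ H ∧ q.1 ≠ u ∧ q.2 ≠ v ∧
    s(u, q.1) ∉ G ∧ s(v, q.2) ∉ G)

lemma mem_swX {n : ℕ} {H G : Graph n} {u v : Fin n} {q : Fin n × Fin n} :
    q ∈ swX H G u v ↔ s(q.1, q.2) ∈ G ∧ s(q.1, q.2) ∉ H ∧ q.1 ≠ u ∧ q.2 ≠ v ∧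
    s(u, q.1) ∉ G ∧ s(v, q.2) ∉ G := by simp [swX]

lemma card_swX {n d : ℕ} {H G : Graph n} (hG : G ∈ regularGraphs n d) (hH : H ⊆ G)
    (u v : Fin n) : n * d ≤ (swX H G u v).card + 2 * H.card + 2 * (d * (d + 1)) := by
  rw [mem_reg] at hG
  have hHs : IsSimpleG H := fun e he => hG.1 e (hH he)
  have h1 : (opairs G).card = n * d := by
    rw [card_opairs hG.1, ← handshake hG.1]
    simp [hG.2]
  have h2 : (opairs H).card = 2 * H.card := card_opairs hHs
  have hnb : ∀ x, (nb G x).card = d := fun x => by rw [← degree_eq, hG.2]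
  set P1 : Finset (Fin n × Fin n) := (insert u (nb G u)).biUnion (fun x => (nb G x).image (fun y => (x, y)))
  set P2 : Finset (Fin n × Fin n) := (insert v (nb G v)).biUnion (fun y => (nb G y).image (fun x => (x, y)))
  have c1 : P1.card ≤ (d + 1) * d := by
    refine (Finset.card_biUnion_le_card_mul _ _ d ?_).trans ?_
    · intro x _; exact Finset.card_image_le.trans (hnb x).le
    · apply Nat.mul_le_mul_right
      exact (Finset.card_insert_le _ _).trans (by rw [hnb])
  have c2 : P2.card ≤ (d + 1) * d := by
    refine (Finset.card_biUnion_le_card_mul _ _ d ?_).trans ?_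
    · intro x _; exact Finset.card_image_le.trans (hnb x).le
    · apply Nat.mul_le_mul_right
      exact (Finset.card_insert_le _ _).trans (by rw [hnb])
  have hsub : opairs G ⊆ ((swX H G u v ∪ opairs H) ∪ P1) ∪ P2 := by
    rintro ⟨x, y⟩ hq
    have hxy : s(x, y) ∈ G := by simpa [opairs] using hq
    have hyx : s(y, x) ∈ G := by rwa [Sym2.eq_swap]
    by_cases hx : x ∈ insert u (nb G u)
    · apply Finset.mem_union_left; apply Finset.mem_union_right
      rw [Finset.mem_biUnion]
      exact ⟨x, hx, Finset.mem_image.2 ⟨y, mem_nb.2 hxy, rfl⟩⟩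
    by_cases hy : y ∈ insert v (nb G v)
    · apply Finset.mem_union_right
      rw [Finset.mem_biUnion]
      exact ⟨y, hy, Finset.mem_image.2 ⟨x, mem_nb.2 hyx, rfl⟩⟩
    apply Finset.mem_union_left; apply Finset.mem_union_left
    rw [Finset.mem_union]
    by_cases hh : s(x, y) ∈ H
    · right; simpa [opairs] using hh
    · left
      rw [Finset.mem_insert, mem_nb, not_or] at hx hy
      rw [mem_swX]
      exact ⟨hxy, hh, hx.1, hy.1, hx.2, hy.2⟩
  have := Finset.card_le_card hsub
  have a1 := Finset.card_union_le ((swX H G u v ∪ opairs H) ∪ P1) P2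
  have a2 := Finset.card_union_le (swX H G u v ∪ opairs H) P1
  have a3 := Finset.card_union_le (swX H G u v) (opairs H)
  have : (d + 1) * d = d * (d + 1) := by ring
  omega

/-- the switched graph -/
def sw {n : ℕ} (G : Graph n) (u v x y : Fin n) : Graph n :=
  insert s(v, y) (insert s(u, x) ((G.erase s(u, v)).erase s(x, y)))

lemma ind_mem {n : ℕ} {a b : Fin n} (h : a ≠ b) (z : Fin n) :
    (if z ∈ s(a, b) then 1 else 0) = (if z = a then 1 else 0) + (if z = b then 1 else 0) := by
  simp only [Sym2.mem_iff]
  by_cases h1 : z = a <;> by_cases h2 : z = b <;> simp_all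

lemma switch {n d : ℕ} (H : Graph n) (e : Sym2 (Fin n)) (he : e ∈ H)
    (hc : 4 * H.card + 4 * (d * (d + 1)) ≤ n * d) :
    ((regularGraphs n d).filter (fun G => H ⊆ G)).card * (n * d) ≤
      2 * (d * d) * ((regularGraphs n d).filter (fun G => H.erase e ⊆ G)).card := by
  induction e using Sym2.ind with
  | _ u v =>
  set A := (regularGraphs n d).filter (fun G => H ⊆ G)
  set B := (regularGraphs n d).filter (fun G => H.erase s(u, v) ⊆ G)
  have hfacts : ∀ G ∈ A, ∀ q ∈ swX H G u v,
      IsSimpleG G ∧ (∀ z, degree G z = d) ∧ s(u, v) ∈ G ∧ u ≠ v ∧ q.1 ≠ q.2 ∧ s(q.1, q.2) ≠ s(u, v) ∧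
      s(v, q.2) ≠ s(u, q.1) := by
    intro G hG q hq
    rw [Finset.mem_filter, mem_reg] at hG
    obtain ⟨⟨g1, g2⟩, g3⟩ := hG
    obtain ⟨q1, q2, q3, q4, q5, q6⟩ := mem_swX.1 hq
    have huv : u ≠ v := by rintro rfl; exact no_loop g1 _ (g3 he)
    refine ⟨g1, g2, g3 he, huv, ?_, ?_, ?_⟩
    · intro h; rw [h] at q1; exact no_loop g1 _ q1
    · intro h; rw [h] at q2; exact q2 he
    · intro h
      rw [Sym2.eq_iff] at h
      rcases h with h | h
      · exact huv h.1.symm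
      · rw [← h.1] at q5; exact q5 (g3 he)
  have hcard : (A.sigma (fun G => swX H G u v)).card ≤ (B.sigma (fun G => nb G u ×ˢ nb G v)).card := by
    apply Finset.card_le_card_of_injOn (fun r => ⟨sw r.1 u v r.2.1 r.2.2, r.2⟩)
    · rintro ⟨G, x, y⟩ hr
      simp only [Finset.coe_sigma, Set.mem_sigma_iff, Finset.mem_coe] at hr
      obtain ⟨hG, hq⟩ := hr
      obtain ⟨g1, g2, g3, huv, hxy, hne, hne2⟩ := hfacts G hG _ hq
      obtain ⟨q1, q2, q3, q4, q5, q6⟩ := mem_swX.1 hq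
      simp only at *
      simp only [Finset.coe_sigma, Set.mem_sigma_iff, Finset.mem_coe, Finset.mem_product, mem_nb]
      refine ⟨?_, by simp [sw], by simp [sw]⟩
      rw [Finset.mem_filter, mem_reg]
      refine ⟨⟨?_, ?_⟩, ?_⟩
      · intro e he
        simp only [sw, Finset.mem_insert, Finset.mem_erase] at he
        rcases he with rfl | rfl | he
        · simpa using q4.symm
        · simpa using q3.symm
        · exact g1 e he.2.2
      · intro z
        have d1 := degree_erase G _ g3 z
        have d2 := degree_erase (G.erase s(u, v)) s(x, y) (by simp [hne, q1]) z
        have d3 := degree_insert ((G.erase s(u, v)).erase s(x, y)) s(u, x) (by simp [q5]) z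
        have d4 := degree_insert (insert s(u, x) ((G.erase s(u, v)).erase s(x, y))) s(v, y)
          (by rw [Finset.mem_insert, not_or]; exact ⟨hne2, by simp [q6]⟩) z
        rw [ind_mem huv] at d1
        rw [ind_mem hxy] at d2
        rw [ind_mem q3.symm] at d3
        rw [ind_mem q4.symm] at d4
        have := g2 z
        unfold sw
        omega
      · intro e he'
        have hG' := (Finset.mem_filter.1 hG).2
        rw [Finset.mem_erase] at he'
        simp only [sw, Finset.mem_insert, Finset.mem_erase]
        right; right
        refine ⟨?_, he'.1, hG' he'.2⟩
        rintro rfl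
        exact q2 he'.2
    · rintro ⟨G, x, y⟩ hr ⟨G', x', y'⟩ hr' heq
      simp only [Finset.coe_sigma, Set.mem_sigma_iff, Finset.mem_coe] at hr hr'
      simp only [Sigma.mk.injEq, heq_eq_eq, Prod.mk.injEq] at heq
      obtain ⟨h1, rfl, rfl⟩ := heq
      have hrec : ∀ G ∈ A, (x, y) ∈ swX H G u v →
          G = insert s(u, v) (insert s(x, y) (((sw G u v x y).erase s(v, y)).erase s(u, x))) := by
        intro G hG hq
        obtain ⟨g1, g2, g3, huv, hxy, hne, hne2⟩ := hfacts G hG _ hq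
        obtain ⟨q1, q2, q3, q4, q5, q6⟩ := mem_swX.1 hq
        simp only at *
        unfold sw
        rw [Finset.erase_insert, Finset.erase_insert, Finset.insert_erase, Finset.insert_erase g3]
        · simp [hne, q1]
        · simp [q5]
        · rw [Finset.mem_insert, not_or]; exact ⟨hne2, by simp [q6]⟩
      have e1 := hrec G hr.1 hr.2
      have e2 := hrec G' hr'.1 hr'.2
      rw [h1] at e1
      rw [← e2] at e1
      subst e1
      rfl
  rw [Finset.card_sigma, Finset.card_sigma] at hcard
  have hB : ∑ G ∈ B, (nb G u ×ˢ nb G v).card = B.card * (d * d) := by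
    rw [Finset.sum_const_nat]
    intro G hG
    have := (mem_reg.1 (Finset.mem_filter.1 hG).1).2
    rw [Finset.card_product, ← degree_eq, ← degree_eq, this, this]
  have hA : A.card * (n * d) ≤ ∑ G ∈ A, 2 * (swX H G u v).card := by
    rw [← smul_eq_mul]
    apply Finset.card_nsmul_le_sum
    intro G hG
    have := card_swX (Finset.mem_filter.1 hG).1 (Finset.mem_filter.1 hG).2 u v
    omega
  rw [← Finset.mul_sum] at hA
  rw [hB] at hcard
  calc _ ≤ _ := hA
    _ ≤ 2 * (B.card * (d * d)) := Nat.mul_le_mul_left _ hcard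
    _ = _ := by ring

lemma switch_real {n d : ℕ} (hn : 0 < n) (hd : 0 < d) : ∀ (m : ℕ) (H : Graph n), H.card = m →
    4 * m + 4 * (d * (d + 1)) ≤ n * d →
    (((regularGraphs n d).filter (fun G => H ⊆ G)).card : ℝ) ≤
      (2 * d / n) ^ m * (regularGraphs n d).card := by
  intro m
  induction m with
  | zero =>
    intro H hH _
    simp only [pow_zero, one_mul]
    exact_mod_cast Finset.card_filter_le _ _
  | succ m ih =>
    intro H hH hc
    have hne : H.Nonempty := by rw [← Finset.card_pos]; omega
    obtain ⟨e, he⟩ := hne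
    have h1 := switch (d := d) H e he (by rw [hH]; exact hc)
    have h2 := ih (H.erase e) (by rw [Finset.card_erase_of_mem he, hH]; rfl) (by omega)
    have h1' : (((regularGraphs n d).filter (fun G => H ⊆ G)).card : ℝ) * (n * d) ≤
      2 * (d * d) * ((regularGraphs n d).filter (fun G => H.erase e ⊆ G)).card := by
      exact_mod_cast h1
    have hn' : (0 : ℝ) < n := by exact_mod_cast hn
    have hd' : (0 : ℝ) < d := by exact_mod_cast hd
    have h3 : (((regularGraphs n d).filter (fun G => H ⊆ G)).card : ℝ) ≤
      (2 * d / n) * ((regularGraphs n d).filter (fun G => H.erase e ⊆ G)).card := by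
      rw [div_mul_eq_mul_div, le_div_iff₀ hn']
      apply le_of_mul_le_mul_right _ hd'
      linarith
    refine h3.trans ?_
    rw [pow_succ']
    rw [mul_assoc]
    exact mul_le_mul_of_nonneg_left h2 (by positivity)

end GM
namespace GM

lemma weak_sum {α : Type*} [DecidableEq α] (Q : ℝ) (a : α → ℝ) : ∀ (k : ℕ) (s : Finset α),
    s.card = k → (∀ r : ℝ, 0 < r → r * (s.filter (fun i => r ≤ a i)).card ≤ Q) → 0 ≤ Q →
    ∑ i ∈ s, a i ≤ Q * ∑ j ∈ Finset.range k, (1 : ℝ) / (j + 1) := by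
  intro k
  induction k with
  | zero => intro s hs _ _; rw [Finset.card_eq_zero] at hs; simp [hs]
  | succ k ih =>
    intro s hs h hQ
    have hne : s.Nonempty := by rw [← Finset.card_pos]; omega
    obtain ⟨m, hm, hmin⟩ := Finset.exists_min_image s a hne
    rw [← Finset.add_sum_erase s a hm, Finset.sum_range_succ, mul_add, add_comm]
    apply add_le_add
    · apply ih _ (by rw [Finset.card_erase_of_mem hm, hs]; rfl) _ hQ
      intro r hr
      refine le_trans ?_ (h r hr)
      apply mul_le_mul_of_nonneg_left _ hr.le
      exact_mod_cast Finset.card_le_card (Finset.filter_subset_filter _ (Finset.erase_subset _ _))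
    · by_cases h0 : 0 < a m
      · have := h (a m) h0
        rw [Finset.filter_true_of_mem hmin, hs] at this
        push_cast at this
        rw [mul_one_div, le_div_iff₀ (by positivity)]
        exact this
      · have : 0 ≤ Q * (1 / ((k : ℝ) + 1)) := by positivity
        linarith

/-- harmonic sum -/
def hsum (n : ℕ) : ℝ := ∑ j ∈ Finset.range n, (1 : ℝ) / (j + 1)

lemma half_weak {n : ℕ} (κ : ℝ) (hκ : 0 ≤ κ) (v : Fin n → ℝ)
    (h : ∀ S : Finset (Fin n), ∑ i ∈ S, v i ≤ κ * Real.sqrt S.card) (s : ℝ) (hs : 0 < s) :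
    s ^ 2 * (Finset.univ.filter (fun i => s ≤ v i)).card ≤ κ ^ 2 := by
  set S := Finset.univ.filter (fun i => s ≤ v i)
  have h1 : s * S.card ≤ ∑ i ∈ S, v i := by
    have := Finset.card_nsmul_le_sum S v s (fun i hi => by simpa [S] using hi)
    rw [nsmul_eq_mul] at this; linarith
  have h2 := h1.trans (h S)
  have hc : (0 : ℝ) ≤ S.card := by positivity
  have hq := Real.sq_sqrt hc
  have hq0 := Real.sqrt_nonneg (S.card : ℝ)
  set q := Real.sqrt (S.card : ℝ)
  rw [← hq] at h2 ⊢
  by_cases hq1 : q = 0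
  · rw [hq1]; simp; positivity
  have hqp : 0 < q := lt_of_le_of_ne hq0 (Ne.symm hq1)
  have h3 : s * q ≤ κ := by
    have : (s * q) * q ≤ κ * q := by nlinarith
    exact le_of_mul_le_mul_right this hqp
  have : 0 ≤ s * q := by positivity
  nlinarith

lemma strong_of_weak {n : ℕ} (κ : ℝ) (hκ : 0 ≤ κ) (v : Fin n → ℝ)
    (h : ∀ S : Finset (Fin n), |∑ i ∈ S, v i| ≤ κ * Real.sqrt S.card) :
    ∑ i, v i ^ 2 ≤ 2 * κ ^ 2 * hsum n := by
  apply weak_sum _ _ n Finset.univ (by simp) _ (by positivity)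
  intro r hr
  set s := Real.sqrt r
  have hs : 0 < s := Real.sqrt_pos.2 hr
  have hsr : s ^ 2 = r := Real.sq_sqrt hr.le
  have a1 := half_weak κ hκ v (fun S => (abs_le.1 (h S)).2) s hs
  have a2 := half_weak κ hκ (fun i => - v i) (fun S => by
    rw [Finset.sum_neg_distrib]; have := (abs_le.1 (h S)).1; linarith) s hs
  have hsub : (Finset.univ.filter (fun i => r ≤ v i ^ 2)) ⊆
      (Finset.univ.filter (fun i => s ≤ v i)) ∪ (Finset.univ.filter (fun i => s ≤ - v i)) := by
    intro i hi
    simp only [Finset.mem_filter, Finset.mem_univ, true_and, Finset.mem_union] at hi ⊢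
    rw [← hsr, sq_le_sq, abs_of_pos hs, le_abs] at hi
    exact hi
  have hcard : ((Finset.univ.filter (fun i => r ≤ v i ^ 2)).card : ℝ) ≤
      (Finset.univ.filter (fun i => s ≤ v i)).card + (Finset.univ.filter (fun i => s ≤ - v i)).card := by
    exact_mod_cast (Finset.card_le_card hsub).trans (Finset.card_union_le _ _)
  calc r * _ ≤ r * _ := mul_le_mul_of_nonneg_left hcard hr.le
    _ ≤ _ := by rw [← hsr]; linarith

lemma hsum_nonneg (n : ℕ) : 0 ≤ hsum n := Finset.sum_nonneg (fun j _ => by positivity)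

lemma specNorm_le {n : ℕ} (B : Matrix (Fin n) (Fin n) ℝ) (hB : ∀ i j, B i j = B j i) (K : ℝ)
    (hK : 0 ≤ K)
    (h : ∀ S T : Finset (Fin n), |∑ i ∈ S, ∑ j ∈ T, B i j| ≤
      K * (Real.sqrt S.card * Real.sqrt T.card)) :
    specNorm B ≤ 2 * K * hsum n := by
  have hH := hsum_nonneg n
  have step1 : ∀ T : Finset (Fin n), ∑ i, (∑ j ∈ T, B i j) ^ 2 ≤ 2 * K ^ 2 * T.card * hsum n := by
    intro T
    have := strong_of_weak (K * Real.sqrt T.card) (by positivity) (fun i => ∑ j ∈ T, B i j)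
      (fun S => (h S T).trans (le_of_eq (by ring)))
    rw [mul_pow, Real.sq_sqrt (by positivity)] at this
    linarith
  have step2 : ∀ y : Fin n → ℝ, ∑ i, (∑ j, B i j * y j) ^ 2 ≤
      (2 * K * hsum n) ^ 2 * ∑ j, y j ^ 2 := by
    intro y
    have hy : 0 ≤ ∑ j, y j ^ 2 := Finset.sum_nonneg (fun _ _ => sq_nonneg _)
    have := strong_of_weak (K * Real.sqrt (2 * hsum n) * Real.sqrt (∑ j, y j ^ 2)) (by positivity)
      (fun i => ∑ j, B i j * y j) (fun S => by
        have e : ∑ i ∈ S, ∑ j, B i j * y j = ∑ j, (∑ i ∈ S, B j i) * y j := by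
          rw [Finset.sum_comm]
          refine Finset.sum_congr rfl (fun j _ => ?_)
          rw [Finset.sum_mul]
          exact Finset.sum_congr rfl (fun i _ => by rw [hB])
        rw [e]
        apply Real.abs_le_sqrt _ |>.trans
        · have : ((K * Real.sqrt (2 * hsum n) * Real.sqrt (∑ j, y j ^ 2)) * Real.sqrt S.card)
            = Real.sqrt ((2 * K ^ 2 * S.card * hsum n) * ∑ j, y j ^ 2) := by
            rw [eq_comm, Real.sqrt_eq_iff_mul_self_eq (by positivity) (by positivity)]
            have e1 := Real.sq_sqrt (show 0 ≤ 2 * hsum n by positivity)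
            have e2 := Real.sq_sqrt hy
            have e3 := Real.sq_sqrt (show (0 : ℝ) ≤ S.card by positivity)
            symm
            calc _ = K ^ 2 * (Real.sqrt (2 * hsum n)) ^ 2 * (Real.sqrt (∑ j, y j ^ 2)) ^ 2
                * (Real.sqrt S.card) ^ 2 := by ring
              _ = _ := by rw [e1, e2, e3]; ring
          rw [this]
        · refine (Finset.sum_mul_sq_le_sq_mul_sq _ _ _).trans ?_
          exact mul_le_mul_of_nonneg_right (step1 S) hy)
    refine this.trans (le_of_eq ?_)
    rw [mul_pow, mul_pow, Real.sq_sqrt hy, Real.sq_sqrt (by positivity)]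
    ring
  unfold specNorm
  apply ContinuousLinearMap.opNorm_le_bound _ (by positivity)
  intro y
  rw [EuclideanSpace.norm_eq, EuclideanSpace.norm_eq]
  rw [← Real.sqrt_sq (show 0 ≤ 2 * K * hsum n by positivity), ← Real.sqrt_mul (by positivity)]
  apply Real.sqrt_le_sqrt
  have := step2 (fun j => y j)
  simpa [Matrix.toLpLin_apply, Matrix.mulVec, dotProduct] using this

lemma hsum_le (n : ℕ) : hsum n ≤ 1 + Real.log n := by
  have := harmonic_le_one_add_log n
  refine le_trans (le_of_eq ?_) this
  simp [hsum, harmonic]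

end GM
namespace GM

/-- multiplicity of an edge in `S × T` -/
def wt {n : ℕ} (S T : Finset (Fin n)) (e : Sym2 (Fin n)) : ℝ :=
  ∑ i ∈ S, ∑ j ∈ T, if s(i, j) = e then 1 else 0

/-- ordered edge count between `S` and `T` -/
def eST {n : ℕ} (S T : Finset (Fin n)) (G : Graph n) : ℝ :=
  ∑ i ∈ S, ∑ j ∈ T, if s(i, j) ∈ G then 1 else 0

lemma sum_wt {n : ℕ} (S T : Finset (Fin n)) (G : Graph n) : ∑ e ∈ G, wt S T e = eST S T G := by
  unfold wt eST
  rw [Finset.sum_comm]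
  refine Finset.sum_congr rfl (fun i _ => ?_)
  rw [Finset.sum_comm]
  refine Finset.sum_congr rfl (fun j _ => ?_)
  rw [Finset.sum_ite_eq]

lemma wt_nonneg {n : ℕ} (S T : Finset (Fin n)) (e : Sym2 (Fin n)) : 0 ≤ wt S T e :=
  Finset.sum_nonneg (fun _ _ => Finset.sum_nonneg (fun _ _ => by split_ifs <;> norm_num))

lemma wt_le_two {n : ℕ} (S T : Finset (Fin n)) (e : Sym2 (Fin n)) : wt S T e ≤ 2 := by
  induction e using Sym2.ind with
  | _ a b =>
  unfold wt
  have h1 : ∀ i ∈ S, ∀ j ∈ T, (if s(i, j) = s(a, b) then (1 : ℝ) else 0) ≤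
      (if i = a then 1 else 0) * (if j = b then 1 else 0) +
      (if i = b then 1 else 0) * (if j = a then 1 else 0) := by
    intro i _ j _
    simp only [Sym2.eq_iff]
    by_cases h1 : i = a <;> by_cases h2 : j = b <;> by_cases h3 : i = b <;> by_cases h4 : j = a <;>
      simp [h1, h2, h3, h4] <;> (try split_ifs) <;> (try norm_num)
  refine (Finset.sum_le_sum (fun i hi => Finset.sum_le_sum (h1 i hi))).trans ?_
  simp_rw [Finset.sum_add_distrib, ← Finset.mul_sum, ← Finset.sum_mul]
  have h2 : ∀ (U : Finset (Fin n)) (x : Fin n), 0 ≤ (∑ i ∈ U, if i = x then (1 : ℝ) else 0) ∧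
      (∑ i ∈ U, if i = x then (1 : ℝ) else 0) ≤ 1 := by
    intro U x
    rw [Finset.sum_ite_eq']
    split_ifs <;> norm_num
  have := h2 S a
  have := h2 S b
  have := h2 T a
  have := h2 T b
  nlinarith

lemma eST_le {n : ℕ} (S T : Finset (Fin n)) (G : Graph n) : eST S T G ≤ S.card * T.card := by
  unfold eST
  calc _ ≤ ∑ i ∈ S, ∑ j ∈ T, (1 : ℝ) := by
        refine Finset.sum_le_sum (fun _ _ => Finset.sum_le_sum (fun _ _ => ?_))
        split_ifs <;> norm_num
    _ = _ := by simp

lemma eST_nonneg {n : ℕ} (S T : Finset (Fin n)) (G : Graph n) : 0 ≤ eST S T G :=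
  Finset.sum_nonneg (fun _ _ => Finset.sum_nonneg (fun _ _ => by split_ifs <;> norm_num))

lemma eST_comm {n : ℕ} (S T : Finset (Fin n)) (G : Graph n) : eST S T G = eST T S G := by
  unfold eST
  rw [Finset.sum_comm]
  refine Finset.sum_congr rfl (fun i _ => Finset.sum_congr rfl (fun j _ => ?_))
  rw [Sym2.eq_swap]

lemma eST_le_deg {n d : ℕ} (S T : Finset (Fin n)) {G : Graph n} (hG : G ∈ regularGraphs n d) :
    eST S T G ≤ d * S.card := by
  have h2 := (mem_reg.1 hG).2
  unfold eST
  calc _ ≤ ∑ i ∈ S, (d : ℝ) := by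
        refine Finset.sum_le_sum (fun i _ => ?_)
        rw [← h2 i, degree_eq]
        rw [Finset.sum_boole]
        have : (T.filter (fun j => s(i, j) ∈ G)) ⊆ nb G i := by
          intro j hj
          rw [Finset.mem_filter] at hj
          exact mem_nb.2 hj.2
        exact_mod_cast Finset.card_le_card this
    _ = _ := by simp [mul_comm]

lemma card_allE (n : ℕ) : (allE n).card = n.choose 2 := by
  have := Sym2.card_subtype_not_diag (α := Fin n)
  rw [Fintype.card_fin, Fintype.card_subtype] at this
  rw [← this]
  unfold allE
  congr

lemma light_count {n d : ℕ} (hn : 2 ≤ n) (hd : d < n) (hev : Even (n * d))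
    (S T : Finset (Fin n)) (l a : ℝ) (hl : |l| ≤ 1 / 2) :
    (((regularGraphs n d).filter (fun G =>
      a ≤ l * (eST S T G - d / (n - 1) * eST S T (allE n)))).card : ℝ) ≤
    (n : ℝ) ^ n * (n ^ 2) * Real.exp (- a + 2 * (d / (n - 1)) * l ^ 2 * (S.card * T.card))
      * (regularGraphs n d).card := by
  obtain ⟨M, hM⟩ := hev
  have hM2 : n * d = 2 * M := by omega
  have henum := enum_bound hM2
  set N := (allE n).card with hN
  have hNr : (N : ℝ) = n * (n - 1) / 2 := by rw [hN, card_allE, Nat.cast_choose_two]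
  have hn' : (2 : ℝ) ≤ n := by exact_mod_cast hn
  have hd' : (d : ℝ) + 1 ≤ n := by exact_mod_cast hd
  have hMr : (n : ℝ) * d = 2 * M := by exact_mod_cast hM2
  have hNpos : 0 < N := by
    have : (0 : ℝ) < N := by rw [hNr]; nlinarith
    exact_mod_cast this
  have hMN : M ≤ N := by
    have : (M : ℝ) ≤ N := by rw [hNr]; nlinarith
    exact_mod_cast this
  set p : ℝ := d / (n - 1) with hp
  have hp0 : p = (M : ℝ) / N := by
    rw [hp, hNr]
    have : (n : ℝ) - 1 ≠ 0 := by linarith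
    have : (n : ℝ) ≠ 0 := by linarith
    field_simp
    linarith
  have hp_nn : 0 ≤ p := by rw [hp0]; positivity
  have hp_1 : p ≤ 1 := by rw [hp, div_le_one (by linarith)]; linarith
  have hmode := mode_bound_real N M hMN hNpos p hp0
  set θ := p ^ M * (1 - p) ^ (N - M) with hθ
  have hθ0 : 0 ≤ θ := by
    have : 0 ≤ 1 - p := by linarith
    positivity
  have hθpos : 0 < θ := by
    rcases hθ0.eq_or_lt with h | h
    · rw [← h] at hmode; simp at hmode; linarith
    · exact h
  have hmgf := mgf_bound (allE n) M p hp_nn hp_1 (fun e => l * wt S T e) (by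
    intro e _
    rw [abs_mul, abs_of_nonneg (wt_nonneg S T e)]
    have := wt_le_two S T e
    have := wt_nonneg S T e
    nlinarith [abs_nonneg l])
  rw [← hN, ← hθ] at hmgf
  simp_rw [← Finset.mul_sum, sum_wt] at hmgf
  set W := eST S T (allE n) with hW
  have hsq : ∑ e ∈ allE n, (l * wt S T e) ^ 2 ≤ l ^ 2 * (2 * (S.card * T.card)) := by
    calc _ ≤ ∑ e ∈ allE n, l ^ 2 * (2 * wt S T e) := by
          refine Finset.sum_le_sum (fun e _ => ?_)
          rw [mul_pow]
          apply mul_le_mul_of_nonneg_left _ (sq_nonneg _)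
          nlinarith [wt_le_two S T e, wt_nonneg S T e]
      _ = l ^ 2 * (2 * W) := by rw [← Finset.mul_sum, ← Finset.mul_sum, sum_wt]
      _ ≤ _ := by
          apply mul_le_mul_of_nonneg_left _ (sq_nonneg _)
          have := eST_le S T (allE n)
          linarith
  set R := regularGraphs n d
  set bad := R.filter (fun G => a ≤ l * (eST S T G - p * W)) with hbad
  have h1 : (bad.card : ℝ) * Real.exp (a + l * (p * W)) ≤
      ∑ G ∈ (allE n).powersetCard M, Real.exp (l * eST S T G) := by
    calc (bad.card : ℝ) * Real.exp (a + l * (p * W)) = ∑ G ∈ bad, Real.exp (a + l * (p * W)) := by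
          simp
      _ ≤ ∑ G ∈ bad, Real.exp (l * eST S T G) := by
          refine Finset.sum_le_sum (fun G hG => ?_)
          rw [hbad, Finset.mem_filter] at hG
          apply Real.exp_le_exp.2
          linarith [hG.2]
      _ ≤ _ := by
          apply Finset.sum_le_sum_of_subset_of_nonneg
          · intro G hG
            have hG := mem_reg.1 (Finset.mem_filter.1 hG).1
            rw [Finset.mem_powersetCard, ← simple_iff]
            refine ⟨hG.1, ?_⟩
            have := handshake hG.1
            simp [hG.2] at this
            omega
          · intro _ _ _; positivity
  have henum' : (N.choose M : ℝ) ≤ n ^ n * R.card := by exact_mod_cast henum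
  have hmode2 : 1 ≤ ((n : ℝ) ^ n * n ^ 2 * R.card) * θ := by
    refine hmode.trans ?_
    have hN1 : (N : ℝ) + 1 ≤ n ^ 2 := by rw [hNr]; nlinarith
    calc ((N : ℝ) + 1) * (N.choose M * θ) ≤ n ^ 2 * ((n ^ n * R.card) * θ) := by gcongr
      _ = _ := by ring
  have h2 : (bad.card : ℝ) * Real.exp (a + l * (p * W)) * θ ≤
      Real.exp (p * (l * W) + 2 * p * l ^ 2 * (S.card * T.card)) := by
    refine (mul_le_mul_of_nonneg_right h1 hθ0).trans (hmgf.trans ?_)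
    apply Real.exp_le_exp.2
    nlinarith
  have h3 : (bad.card : ℝ) * θ ≤ Real.exp (- a + 2 * p * l ^ 2 * (S.card * T.card)) := by
    have e : Real.exp (p * (l * W) + 2 * p * l ^ 2 * (S.card * T.card)) =
        Real.exp (- a + 2 * p * l ^ 2 * (S.card * T.card)) * Real.exp (a + l * (p * W)) := by
      rw [← Real.exp_add]; congr 1; ring
    rw [e] at h2
    apply le_of_mul_le_mul_right _ (Real.exp_pos (a + l * (p * W)))
    linarith
  apply le_of_mul_le_mul_right _ hθpos
  refine h3.trans ?_
  have := mul_le_mul_of_nonneg_left hmode2 (Real.exp_pos (- a + 2 * p * l ^ 2 * (S.card * T.card))).le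
  rw [mul_one] at this
  refine this.trans (le_of_eq ?_)
  ring

lemma heavy_count {n d : ℕ} (hn : 0 < n) (hd : 0 < d) (S T : Finset (Fin n)) (m : ℕ)
    (hc : 4 * m + 4 * (d * (d + 1)) ≤ n * d) :
    (((regularGraphs n d).filter (fun G => (2 * m : ℝ) ≤ eST S T G)).card : ℝ) ≤
      (2 * d / n * (S.card * T.card)) ^ m / m.factorial * (regularGraphs n d).card := by
  set R := regularGraphs n d
  set P : Graph n := (S ×ˢ T).image (fun q => s(q.1, q.2)) with hP
  have hPc : P.card ≤ S.card * T.card := by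
    refine Finset.card_image_le.trans ?_
    rw [Finset.card_product]
  have hz : ∀ G : Graph n, eST S T G ≤ 2 * (G ∩ P).card := by
    intro G
    rw [← sum_wt]
    have : ∑ e ∈ G, wt S T e = ∑ e ∈ G ∩ P, wt S T e := by
      symm
      apply Finset.sum_subset Finset.inter_subset_left
      intro e he hne
      have hne : e ∉ P := fun h => hne (Finset.mem_inter.2 ⟨he, h⟩)
      unfold wt
      refine Finset.sum_eq_zero (fun i hi => Finset.sum_eq_zero (fun j hj => ?_))
      rw [if_neg]
      rintro rfl
      exact hne (Finset.mem_image.2 ⟨(i, j), Finset.mem_product.2 ⟨hi, hj⟩, rfl⟩)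
    rw [this]
    calc _ ≤ ∑ e ∈ G ∩ P, (2 : ℝ) := Finset.sum_le_sum (fun e _ => wt_le_two S T e)
      _ = _ := by simp [mul_comm]
  have hsub : R.filter (fun G => (2 * m : ℝ) ≤ eST S T G) ⊆
      (P.powersetCard m).biUnion (fun H => R.filter (fun G => H ⊆ G)) := by
    intro G hG
    rw [Finset.mem_filter] at hG
    have h1 := hG.2.trans (hz G)
    have h2 : m ≤ (G ∩ P).card := by
      have : (m : ℝ) ≤ (G ∩ P).card := by linarith
      exact_mod_cast this
    obtain ⟨H, hH, hHc⟩ := Finset.exists_subset_card_eq h2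
    rw [Finset.mem_biUnion]
    refine ⟨H, Finset.mem_powersetCard.2 ⟨hH.trans Finset.inter_subset_right, hHc⟩, ?_⟩
    exact Finset.mem_filter.2 ⟨hG.1, hH.trans Finset.inter_subset_left⟩
  have h1 : ((R.filter (fun G => (2 * m : ℝ) ≤ eST S T G)).card : ℝ) ≤
      ∑ H ∈ P.powersetCard m, ((R.filter (fun G => H ⊆ G)).card : ℝ) := by
    exact_mod_cast (Finset.card_le_card hsub).trans Finset.card_biUnion_le
  refine h1.trans ?_
  have h2 : ∑ H ∈ P.powersetCard m, ((R.filter (fun G => H ⊆ G)).card : ℝ) ≤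
      ∑ H ∈ P.powersetCard m, (2 * d / n : ℝ) ^ m * R.card := by
    refine Finset.sum_le_sum (fun H hH => ?_)
    exact switch_real hn hd m H (Finset.mem_powersetCard.1 hH).2 hc
  refine h2.trans ?_
  rw [Finset.sum_const, nsmul_eq_mul, Finset.card_powersetCard]
  have h3 : (P.card.choose m : ℝ) ≤ ((S.card * T.card : ℝ)) ^ m / m.factorial := by
    refine (Nat.choose_le_pow_div m P.card).trans ?_
    have : (P.card : ℝ) ≤ S.card * T.card := by exact_mod_cast hPc
    gcongr
  calc _ ≤ ((S.card * T.card : ℝ)) ^ m / m.factorial * ((2 * d / n : ℝ) ^ m * R.card) := by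
        gcongr
    _ = _ := by rw [mul_pow]; ring

end GM
namespace GM

set_option maxHeartbeats 1000000 in
lemma pair_light {n d : ℕ} (l : ℝ) (hl : l = Real.log n) (hl10 : 10 ≤ l) (hn : 1000 ≤ n)
    (hd1 : 0 < d) (hd2 : (d : ℝ) ≤ n / 1000) (hev : Even (n * d)) (S T : Finset (Fin n))
    (r : ℝ) (hr : r = Real.sqrt (d * S.card * T.card)) (hrn : n ≤ r) :
    (((regularGraphs n d).filter (fun G =>
      (20 * l + 1) * r < |eST S T G - d / n * eST S T (allE n)|)).card : ℝ) ≤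
    Real.exp (- ((S.card + T.card + 2) * l)) * (regularGraphs n d).card := by
  set R := regularGraphs n d
  have hn' : (1000 : ℝ) ≤ n := by exact_mod_cast hn
  have hd0 : (0 : ℝ) < d := by exact_mod_cast hd1
  have hdn : d < n := by
    have : (d : ℝ) < n := by linarith
    exact_mod_cast this
  have hr0 : 0 < r := by linarith
  have hr2 : r ^ 2 = d * S.card * T.card := by rw [hr]; exact Real.sq_sqrt (by positivity)
  have hS : (S.card : ℝ) ≤ n := by
    have := Finset.card_le_univ S
    rw [Fintype.card_fin] at this; exact_mod_cast this
  have hT : (T.card : ℝ) ≤ n := by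
    have := Finset.card_le_univ T
    rw [Fintype.card_fin] at this; exact_mod_cast this
  have hS0 : (0 : ℝ) ≤ S.card := by positivity
  have hT0 : (0 : ℝ) ≤ T.card := by positivity
  set s : ℝ := (S.card : ℝ)
  set t : ℝ := (T.card : ℝ)
  set W := eST S T (allE n)
  have hW : W ≤ s * t := eST_le S T _
  have hW0 : 0 ≤ W := eST_nonneg S T _
  set lam : ℝ := n / (2 * r) with hlam
  have hlam0 : 0 ≤ lam := by positivity
  have hlam1 : lam ≤ 1 / 2 := by
    rw [hlam, div_le_iff₀ (by positivity)]; linarith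
  have hlr : lam * r = n / 2 := by rw [hlam]; field_simp
  have c1 := light_count (by omega) hdn hev S T lam (10 * l * n) (by rwa [abs_of_nonneg hlam0])
  have c2 := light_count (by omega) hdn hev S T (-lam) (10 * l * n)
    (by rwa [abs_neg, abs_of_nonneg hlam0])
  rw [neg_sq] at c2
  set B1 := R.filter (fun G => 10 * l * n ≤ lam * (eST S T G - d / (n - 1) * W))
  set B2 := R.filter (fun G => 10 * l * n ≤ -lam * (eST S T G - d / (n - 1) * W))
  have hst : s * t ≤ n * n := by gcongr
  have hpp : (d / (n - 1) - d / n : ℝ) * W ≤ r := by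
    have e : (d / (n - 1) - d / n : ℝ) = d / (n * (n - 1)) := by
      have : (n : ℝ) - 1 ≠ 0 := by linarith
      field_simp; ring
    rw [e]
    have h1 : (d / (n * (n - 1)) : ℝ) * W ≤ (d / (n * (n - 1)) : ℝ) * (s * t) := by
      apply mul_le_mul_of_nonneg_left hW
      have : (0 : ℝ) < n - 1 := by linarith
      positivity
    refine h1.trans ?_
    rw [div_mul_eq_mul_div, div_le_iff₀ (by nlinarith), ← mul_assoc, ← hr2, sq]
    apply mul_le_mul_of_nonneg_left _ hr0.le
    rw [hr]
    apply Real.sqrt_le_left (by nlinarith) |>.2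
    have : (d : ℝ) ≤ (n - 1) ^ 2 := by nlinarith
    calc (d : ℝ) * s * t = d * (s * t) := by ring
      _ ≤ (n - 1) ^ 2 * (n * n) := by gcongr
      _ = _ := by ring
  have hpp0 : 0 ≤ (d / (n - 1) - d / n : ℝ) * W := by
    apply mul_nonneg _ hW0
    rw [sub_nonneg]
    apply div_le_div_of_nonneg_left hd0.le <;> linarith
  have hsub : R.filter (fun G => (20 * l + 1) * r < |eST S T G - d / n * W|) ⊆ B1 ∪ B2 := by
    intro G hG
    rw [Finset.mem_filter] at hG
    rw [Finset.mem_union, Finset.mem_filter, Finset.mem_filter]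
    have h := hG.2
    rcases lt_abs.1 h with h | h
    · left
      refine ⟨hG.1, ?_⟩
      have h1 : 20 * l * r ≤ eST S T G - d / (n - 1) * W := by linarith
      have := mul_le_mul_of_nonneg_left h1 hlam0
      refine le_trans (le_of_eq ?_) this
      linear_combination (-20 * l) * hlr
    · right
      refine ⟨hG.1, ?_⟩
      have h1 : 20 * l * r ≤ -(eST S T G - d / (n - 1) * W) := by linarith
      have := mul_le_mul_of_nonneg_left h1 hlam0
      refine le_trans (le_of_eq ?_) (this.trans (le_of_eq ?_))
      · linear_combination (-20 * l) * hlr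
      · ring
  have hc : ((R.filter (fun G => (20 * l + 1) * r < |eST S T G - d / n * W|)).card : ℝ) ≤
      B1.card + B2.card := by
    exact_mod_cast (Finset.card_le_card hsub).trans (Finset.card_union_le _ _)
  refine hc.trans ((add_le_add c1 c2).trans ?_)
  rw [← two_mul, ← mul_assoc]
  apply mul_le_mul_of_nonneg_right _ (by positivity)
  have hexpl : Real.exp l = n := by rw [hl]; exact Real.exp_log (by linarith)
  have e1 : (n : ℝ) ^ n = Real.exp (n * l) := by rw [Real.exp_nat_mul, hexpl]
  have e2 : (n : ℝ) ^ 2 = Real.exp (2 * l) := by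
    have := Real.exp_nat_mul l 2
    push_cast at this
    rw [this, hexpl]
  have e3 : (2 : ℝ) ≤ Real.exp 1 := by have := Real.add_one_le_exp 1; linarith
  have e4 : 2 * (d / (n - 1)) * lam ^ 2 * (s * t) ≤ (n : ℝ) := by
    have hx : lam ^ 2 * (d * s * t) = n ^ 2 / 4 := by
      rw [← hr2]; linear_combination (lam * r + n / 2) * hlr
    have : 2 * (d / (n - 1)) * lam ^ 2 * (s * t) = 2 * (lam ^ 2 * (d * s * t)) / ((n : ℝ) - 1) := by
      field_simp
    rw [this, hx, div_le_iff₀ (by linarith)]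
    have hnn : 1000 * (n : ℝ) ≤ n * n := by gcongr
    linarith
  rw [e1, e2]
  calc 2 * (Real.exp (n * l) * Real.exp (2 * l) * Real.exp (-(10 * l * n) + 2 * (d / (n - 1)) * lam ^ 2 * (s * t)))
      ≤ Real.exp 1 * (Real.exp (n * l) * Real.exp (2 * l) * Real.exp (-(10 * l * n) + n)) := by
        gcongr
    _ = Real.exp (1 + (n * l + 2 * l + (-(10 * l * n) + n))) := by
        rw [← Real.exp_add, ← Real.exp_add, ← Real.exp_add]
    _ ≤ _ := by
        apply Real.exp_le_exp.2
        have f1 : s * l ≤ n * l := by gcongr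
        have f2 : t * l ≤ n * l := by gcongr
        have f3 : (n : ℝ) * 10 ≤ n * l := by gcongr
        have f4 : 1000 * l ≤ n * l := by gcongr
        linarith

set_option maxHeartbeats 1000000 in
lemma pair_heavy {n d : ℕ} (l : ℝ) (hl10 : 10 ≤ l) (hn : 1000 ≤ n)
    (hd1 : 100 * l ≤ d) (hd2 : (d : ℝ) ≤ n / 1000) (S T : Finset (Fin n))
    (r : ℝ) (hr : r = Real.sqrt (d * S.card * T.card)) (hrn : r < n) :
    (((regularGraphs n d).filter (fun G =>
      (20 * l + 1) * r < |eST S T G - d / n * eST S T (allE n)|)).card : ℝ) ≤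
    Real.exp (- ((S.card + T.card + 2) * l)) * (regularGraphs n d).card := by
  set R := regularGraphs n d
  have hn' : (1000 : ℝ) ≤ n := by exact_mod_cast hn
  have hd0 : (0 : ℝ) < d := by linarith
  have hd0' : 0 < d := by exact_mod_cast hd0
  have hr0 : 0 ≤ r := by rw [hr]; positivity
  have hr2 : r ^ 2 = d * S.card * T.card := by rw [hr]; exact Real.sq_sqrt (by positivity)
  have hW : eST S T (allE n) ≤ S.card * T.card := eST_le S T _
  have hW0 : 0 ≤ eST S T (allE n) := eST_nonneg S T _
  set bad := R.filter (fun G => (20 * l + 1) * r < |eST S T G - d / n * eST S T (allE n)|)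
  have hpW : d / n * eST S T (allE n) ≤ r := by
    have : d / n * eST S T (allE n) ≤ d / n * (S.card * T.card) := by gcongr
    refine this.trans ?_
    rw [div_mul_eq_mul_div, div_le_iff₀ (by linarith), ← mul_assoc, ← hr2]
    nlinarith
  have hpW0 : 0 ≤ d / n * eST S T (allE n) := by positivity
  have hbad : ∀ G ∈ bad, 20 * l * r < eST S T G := by
    intro G hG
    have h := (Finset.mem_filter.1 hG).2
    have := eST_nonneg S T G
    rcases lt_abs.1 h with h | h <;> nlinarith
  rcases Finset.eq_empty_or_nonempty bad with h | ⟨G, hG⟩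
  · rw [h]; simp; positivity
  have hz := hbad G hG
  have hG' := (Finset.mem_filter.1 hG).1
  have z1 := eST_le_deg S T hG'
  have z2 := eST_le_deg T S hG'
  rw [eST_comm] at z2
  have hpos : 0 < eST S T G := lt_of_le_of_lt (by positivity) hz
  have hS1 : (1 : ℝ) ≤ S.card := by
    have : 0 < S.card := by
      rcases Nat.eq_zero_or_pos S.card with h0 | h0
      · rw [h0] at z1; simp at z1; linarith
      · exact h0
    exact_mod_cast this
  have hT1 : (1 : ℝ) ≤ T.card := by
    have : 0 < T.card := by
      rcases Nat.eq_zero_or_pos T.card with h0 | h0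
      · rw [h0] at z2; simp at z2; linarith
      · exact h0
    exact_mod_cast this
  set s : ℝ := (S.card : ℝ)
  set t : ℝ := (T.card : ℝ)
  have key : ∀ a b : ℝ, 1 ≤ a → 1 ≤ b → r ^ 2 = d * a * b → 20 * l * r < d * a → 20 * l * b ≤ r := by
    intro a b ha hb h1 h2
    have h3 : (20 * l * r) ^ 2 < (d * a) ^ 2 := by
      apply pow_lt_pow_left₀ h2 (by positivity) (by norm_num)
    have h4 : (20 * l) ^ 2 * b < d * a := by
      have : ((20 * l) ^ 2 * b) * (d * a) < (d * a) * (d * a) := by nlinarith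
      exact lt_of_mul_lt_mul_right this (by positivity)
    have h5 : (20 * l * b) ^ 2 ≤ r ^ 2 := by
      rw [h1]; nlinarith
    exact (abs_le_of_sq_le_sq' h5 hr0).2
  have k1 := key s t hS1 hT1 hr2 (by linarith)
  have k2 := key t s hT1 hS1 (by rw [hr2]; ring) (by linarith)
  set m := ⌊10 * l * r⌋₊ with hm
  have hm1 : (m : ℝ) ≤ 10 * l * r := Nat.floor_le (by positivity)
  have hm2 : 10 * l * r < m + 1 := Nat.lt_floor_add_one _
  have hr200 : 200 ≤ r := by nlinarith
  have hlr : 2000 ≤ l * r := by nlinarith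
  have hm3 : 5 * l * r ≤ m := by linarith
  have hcond : 4 * m + 4 * (d * (d + 1)) ≤ n * d := by
    have : (4 * m + 4 * (d * (d + 1)) : ℝ) ≤ n * d := by
      have a1 : l * r ≤ l * n := by gcongr
      have a2 : 100 * l * n ≤ d * n := by gcongr
      have a3 : (d : ℝ) * d ≤ d * (n / 1000) := by gcongr
      have a4 : (d : ℝ) * 1000 ≤ d * n := by gcongr
      linarith
    exact_mod_cast this
  have hh := heavy_count (by omega) hd0' S T m hcond
  have hsub : bad ⊆ R.filter (fun G => (2 * m : ℝ) ≤ eST S T G) := by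
    intro G hG
    have := hbad G hG
    refine Finset.mem_filter.2 ⟨(Finset.mem_filter.1 hG).1, ?_⟩
    linarith
  have hc : (bad.card : ℝ) ≤ (R.filter (fun G => (2 * m : ℝ) ≤ eST S T G)).card := by
    exact_mod_cast Finset.card_le_card hsub
  refine hc.trans (hh.trans ?_)
  apply mul_le_mul_of_nonneg_right _ (by positivity)
  have hx : 2 * d / n * (s * t) ≤ 2 * r := by
    have : 2 * d / n * (s * t) = 2 * (r ^ 2 / n) := by rw [hr2]; ring
    rw [this]
    have : r ^ 2 / n ≤ r := by rw [div_le_iff₀ (by linarith)]; nlinarith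
    linarith
  have hx2 : (Real.exp 2) * (2 * r) ≤ m := by
    have he9 : Real.exp 2 ≤ 9 := by
      have := Real.exp_one_lt_d9
      have e : Real.exp 2 = Real.exp 1 ^ 2 := by rw [← Real.exp_nat_mul]; norm_num
      rw [e]
      nlinarith [Real.exp_pos 1]
    have b1 : Real.exp 2 * (2 * r) ≤ 9 * (2 * r) := by gcongr
    have b2 : 10 * r ≤ l * r := by gcongr
    linarith
  have hfac := Real.pow_div_factorial_le_exp (m : ℝ) (by positivity) m
  have hfp : (0 : ℝ) < m.factorial := by exact_mod_cast Nat.factorial_pos m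
  rw [div_le_iff₀ hfp] at hfac
  have hmain : (2 * d / n * (s * t)) ^ m / m.factorial ≤ Real.exp (-m) := by
    rw [div_le_iff₀ hfp]
    have h1 : (2 * d / n * (s * t)) ^ m ≤ (2 * r) ^ m := by gcongr
    have h2 : (Real.exp 2 * (2 * r)) ^ m ≤ (m : ℝ) ^ m := by gcongr
    rw [mul_pow, ← Real.exp_nat_mul] at h2
    have h3 := h2.trans hfac
    have e : Real.exp (m * 2) = Real.exp m * Real.exp m := by rw [← Real.exp_add]; congr 1; ring
    rw [e, mul_assoc] at h3
    have h4 := le_of_mul_le_mul_left h3 (Real.exp_pos m)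
    rw [Real.exp_neg]
    refine h1.trans ?_
    rw [inv_mul_eq_div, le_div_iff₀ (Real.exp_pos _)]
    linarith
  refine hmain.trans (Real.exp_le_exp.2 ?_)
  have f1 : 10 * r ≤ l * r := by gcongr
  have f2 : 10 * s ≤ l * s := by gcongr
  have f3 : 10 * t ≤ l * t := by gcongr
  have f4 : (20 * l * s) * l ≤ r * l := by gcongr
  have f5 : (20 * l * t) * l ≤ r * l := by gcongr
  have f6 : 1 * (l * 1) ≤ l * (l * s) := by gcongr; linarith
  have f7 : 1 * (l * t) ≤ l * (l * t) := by gcongr; linarith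
  have f8 : 1 * (l * s) ≤ l * (l * s) := by gcongr; linarith
  nlinarith

lemma pair_all {n d : ℕ} (l : ℝ) (hl : l = Real.log n) (hl10 : 10 ≤ l) (hn : 1000 ≤ n)
    (hd1 : 100 * l ≤ d) (hd2 : (d : ℝ) ≤ n / 1000) (hev : Even (n * d)) (S T : Finset (Fin n)) :
    (((regularGraphs n d).filter (fun G =>
      (20 * l + 1) * Real.sqrt (d * S.card * T.card) <
        |eST S T G - d / n * eST S T (allE n)|)).card : ℝ) ≤
    Real.exp (- ((S.card + T.card + 2) * l)) * (regularGraphs n d).card := by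
  have hd0 : 0 < d := by
    have : (0 : ℝ) < d := by linarith
    exact_mod_cast this
  rcases le_or_gt (n : ℝ) (Real.sqrt (d * S.card * T.card)) with h | h
  · exact pair_light l hl hl10 hn hd0 hd2 hev S T _ rfl h
  · exact pair_heavy l hl10 hn hd1 hd2 S T _ rfl h

lemma bad_total {n d : ℕ} (l : ℝ) (hl : l = Real.log n) (hl10 : 10 ≤ l) (hn : 1000 ≤ n)
    (hd1 : 100 * l ≤ d) (hd2 : (d : ℝ) ≤ n / 1000) (hev : Even (n * d)) :
    (((regularGraphs n d).filter (fun G => ∃ S T : Finset (Fin n),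
      (20 * l + 1) * Real.sqrt (d * S.card * T.card) <
        |eST S T G - d / n * eST S T (allE n)|)).card : ℝ) ≤
    9 / n ^ 2 * (regularGraphs n d).card := by
  set R := regularGraphs n d
  have hn' : (1000 : ℝ) ≤ n := by exact_mod_cast hn
  have hexpl : Real.exp l = n := by rw [hl]; exact Real.exp_log (by linarith)
  have hsub : R.filter (fun G => ∃ S T : Finset (Fin n),
      (20 * l + 1) * Real.sqrt (d * S.card * T.card) <
        |eST S T G - d / n * eST S T (allE n)|) ⊆
      Finset.univ.biUnion (fun S : Finset (Fin n) => Finset.univ.biUnion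
        (fun T : Finset (Fin n) => R.filter (fun G =>
        (20 * l + 1) * Real.sqrt (d * S.card * T.card) <
        |eST S T G - d / n * eST S T (allE n)|))) := by
    intro G hG
    rw [Finset.mem_filter] at hG
    obtain ⟨h1, S, T, h2⟩ := hG
    simp only [Finset.mem_biUnion, Finset.mem_univ, true_and]
    exact ⟨S, T, Finset.mem_filter.2 ⟨h1, h2⟩⟩
  have h1 : ((R.filter (fun G => ∃ S T : Finset (Fin n),
      (20 * l + 1) * Real.sqrt (d * S.card * T.card) <
        |eST S T G - d / n * eST S T (allE n)|)).card : ℝ) ≤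
      ∑ S : Finset (Fin n), ∑ T : Finset (Fin n), ((R.filter (fun G =>
        (20 * l + 1) * Real.sqrt (d * S.card * T.card) <
        |eST S T G - d / n * eST S T (allE n)|)).card : ℝ) := by
    refine le_trans (Nat.cast_le.2 (Finset.card_le_card hsub)) ?_
    refine le_trans (Nat.cast_le.2 (Finset.card_biUnion_le)) ?_
    push_cast
    refine Finset.sum_le_sum (fun S _ => ?_)
    refine le_trans (Nat.cast_le.2 (Finset.card_biUnion_le)) ?_
    push_cast
    exact le_rfl
  refine h1.trans ?_
  have h2 : ∀ S T : Finset (Fin n), ((R.filter (fun G =>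
        (20 * l + 1) * Real.sqrt (d * S.card * T.card) <
        |eST S T G - d / n * eST S T (allE n)|)).card : ℝ) ≤
        ((1 / n : ℝ) ^ S.card * (1 / n : ℝ) ^ T.card) * (1 / n ^ 2 * R.card) := by
    intro S T
    refine (pair_all l hl hl10 hn hd1 hd2 hev S T).trans (le_of_eq ?_)
    have : Real.exp (- ((S.card + T.card + 2) * l)) = (1 / n : ℝ) ^ (S.card + T.card + 2) := by
      rw [one_div, inv_pow, ← hexpl, ← Real.exp_nat_mul, ← Real.exp_neg]
      push_cast; ring_nf
    rw [this, pow_add, pow_add]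
    ring
  refine (Finset.sum_le_sum (fun S _ => Finset.sum_le_sum (fun T _ => h2 S T))).trans ?_
  have h3 : ∑ S : Finset (Fin n), (1 / n : ℝ) ^ S.card ≤ 3 := by
    have := Fintype.sum_pow_mul_eq_add_pow (Fin n) (1 / n : ℝ) 1
    simp only [one_pow, mul_one, Fintype.card_fin] at this
    rw [this]
    have h4 : (1 / n + 1 : ℝ) ≤ Real.exp (1 / n) := Real.add_one_le_exp _
    calc (1 / n + 1 : ℝ) ^ n ≤ Real.exp (1 / n) ^ n := by gcongr
      _ = Real.exp 1 := by
        rw [← Real.exp_nat_mul]; congr 1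
        field_simp
      _ ≤ 3 := by have := Real.exp_one_lt_d9; linarith
  have h30 : 0 ≤ ∑ S : Finset (Fin n), (1 / n : ℝ) ^ S.card :=
    Finset.sum_nonneg (fun _ _ => by positivity)
  simp_rw [← Finset.sum_mul, ← Finset.mul_sum, ← Finset.sum_mul]
  set X := ∑ S : Finset (Fin n), (1 / n : ℝ) ^ S.card
  calc X * X * (1 / n ^ 2 * R.card) ≤ 3 * 3 * (1 / n ^ 2 * R.card) := by gcongr
    _ = _ := by ring

lemma good_norm {n d : ℕ} (l : ℝ) (hl : l = Real.log n) (hl10 : 10 ≤ l) (hn : 1000 ≤ n)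
    (hd1 : 100 * l ≤ d) (hd2 : (d : ℝ) ≤ n / 1000) (G : Graph n) (hG : G ∈ regularGraphs n d)
    (h : ∀ S T : Finset (Fin n), |eST S T G - d / n * eST S T (allE n)| ≤
      (20 * l + 1) * Real.sqrt (d * S.card * T.card)) :
    specNorm (Matrix.of fun i j : Fin n => if i = j then 0 else char ((d : ℝ) / n) G s(i, j))
      ≤ 1000 * Real.sqrt n * l ^ 2 := by
  have hn' : (1000 : ℝ) ≤ n := by exact_mod_cast hn
  have hd0 : (0 : ℝ) < d := by linarith
  have hGs := (mem_reg.1 hG).1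
  set p : ℝ := d / n with hp
  have hp0 : 0 < p := by positivity
  have hp1 : p ≤ 1 / 1000 := by rw [hp, div_le_iff₀ (by linarith)]; linarith
  set σ := Real.sqrt (p * (1 - p)) with hσ
  have hpp : 0 < p * (1 - p) := by nlinarith
  have hσ0 : 0 < σ := Real.sqrt_pos.2 hpp
  have hc1 : Real.sqrt ((1 - p) / p) = (1 - p) / σ := by
    rw [Real.sqrt_eq_iff_mul_self_eq (by have : 0 < 1 - p := by linarith
                                         positivity) (by have : 0 < 1 - p := by linarith
                                                         positivity)]
    rw [div_mul_div_comm, hσ, Real.mul_self_sqrt hpp.le]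
    have : 1 - p ≠ 0 := by linarith
    field_simp
  have hc2 : Real.sqrt (p / (1 - p)) = p / σ := by
    rw [Real.sqrt_eq_iff_mul_self_eq (by have : 0 < 1 - p := by linarith
                                         positivity) (by positivity)]
    rw [div_mul_div_comm, hσ, Real.mul_self_sqrt hpp.le]
    have : 1 - p ≠ 0 := by linarith
    field_simp
  have hent : ∀ i j : Fin n, (if i = j then 0 else char p G s(i, j)) =
      ((if s(i, j) ∈ G then (1 : ℝ) else 0) - p * (if s(i, j) ∈ allE n then 1 else 0)) / σ := by
    intro i j
    by_cases hij : i = j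
    · subst hij
      simp [no_loop hGs, allE]
    · have : s(i, j) ∈ allE n := by simp [allE, hij]
      simp only [hij, if_false, this, if_true, char, hc1, hc2]
      split_ifs <;> ring
  have hent2 : ∀ S T : Finset (Fin n), ∑ i ∈ S, ∑ j ∈ T, (if i = j then 0 else char p G s(i, j)) =
      (eST S T G - p * eST S T (allE n)) / σ := by
    intro S T
    simp_rw [hent, ← Finset.sum_div, Finset.sum_sub_distrib, ← Finset.mul_sum]
    rfl
  have hl2 := hsum_le n
  rw [← hl] at hl2
  have hdσ : Real.sqrt d / σ ≤ 2 * Real.sqrt n := by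
    rw [div_le_iff₀ hσ0]
    apply Real.sqrt_le_left (by positivity) |>.2
    rw [mul_pow, mul_pow, Real.sq_sqrt (by positivity), hσ, Real.sq_sqrt hpp.le]
    have : (n : ℝ) * p = d := by rw [hp]; field_simp
    nlinarith
  have := specNorm_le (Matrix.of fun i j : Fin n => if i = j then 0 else char p G s(i, j))
    (by
      intro i j
      simp only [Matrix.of_apply]
      rw [Sym2.eq_swap]
      simp only [eq_comm])
    ((20 * l + 1) * (2 * Real.sqrt n)) (by positivity) (by
      intro S T
      simp only [Matrix.of_apply]
      rw [hent2, abs_div, abs_of_pos hσ0]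
      calc _ ≤ (20 * l + 1) * Real.sqrt (d * S.card * T.card) / σ := by
            gcongr
            exact h S T
        _ = (20 * l + 1) * (Real.sqrt d / σ) * (Real.sqrt S.card * Real.sqrt T.card) := by
            rw [Real.sqrt_mul (by positivity), Real.sqrt_mul (by positivity)]; ring
        _ ≤ _ := by gcongr)
  refine this.trans ?_
  have hH := hsum_nonneg n
  calc 2 * ((20 * l + 1) * (2 * Real.sqrt n)) * hsum n
      ≤ 2 * ((21 * l) * (2 * Real.sqrt n)) * (2 * l) := by gcongr <;> linarith
    _ ≤ _ := by
      have := Real.sqrt_nonneg n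
      nlinarith [mul_nonneg this (sq_nonneg l)]

end GM
open GM in
/-- The centered, rescaled adjacency matrix of a uniformly random `d`-regular graph has
spectral norm at most `√n` up to a polylogarithmic factor, with high probability. -/
theorem centered_adjacency_norm_bound_regular :
    ∃ C c : ℝ, 0 < C ∧ 0 < c ∧
      ∀ ε : ℝ, 0 < ε → ∃ n₀ : ℕ, ∀ n : ℕ, n₀ ≤ n → ∀ d : ℕ,
        Real.log n ^ 10 ≤ (d : ℝ) → (d : ℝ) ≤ (n : ℝ) / C → Even (n * d) →
        1 - ε ≤ regPr n d (fun G =>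
          specNorm (Matrix.of fun i j : Fin n =>
              if i = j then 0 else char ((d : ℝ) / n) G s(i, j))
            ≤ C * Real.sqrt n * Real.log n ^ c) := by

  refine ⟨1000, 2, by norm_num, by norm_num, ?_⟩
  intro ε hε
  obtain ⟨n₀, hn₀⟩ := exists_nat_ge (max (Real.exp 10) (max 1000 (9 / ε)))
  refine ⟨n₀, ?_⟩
  intro n hn d hd1 hd2 hev
  have hnr : max (Real.exp 10) (max 1000 (9 / ε)) ≤ (n : ℝ) :=
    hn₀.trans (by exact_mod_cast hn)
  have h1 : Real.exp 10 ≤ n := (le_max_left _ _).trans hnr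
  have h2 : (1000 : ℝ) ≤ n := (le_max_left _ _).trans ((le_max_right _ _).trans hnr)
  have h3 : 9 / ε ≤ (n : ℝ) := (le_max_right _ _).trans ((le_max_right _ _).trans hnr)
  have hn1000 : 1000 ≤ n := by exact_mod_cast h2
  have hl10 : 10 ≤ Real.log n := by
    rw [Real.le_log_iff_exp_le (by linarith)]; exact h1
  have hd100 : 100 * Real.log n ≤ d := by
    refine le_trans ?_ hd1
    have e : Real.log n ^ 10 = Real.log n ^ 9 * Real.log n := by ring
    have : (10 : ℝ) ^ 9 ≤ Real.log n ^ 9 := by gcongr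
    rw [e]
    nlinarith
  have htot := bad_total (Real.log n) rfl hl10 hn1000 hd100 hd2 hev
  have hgood := good_norm (Real.log n) rfl hl10 hn1000 hd100 hd2
  have hdn : d ≤ n - 1 := by
    have : (d : ℝ) < n := by linarith
    have : d < n := by exact_mod_cast this
    omega
  have hpos : 0 < (regularGraphs n d).card := by
    obtain ⟨M, hM⟩ := hev
    have henum := enum_bound (n := n) (d := d) (M := M) (by omega)
    have hMN : M ≤ (allE n).card := by
      rw [card_allE, Nat.choose_two_right, Nat.le_div_iff_mul_le (by norm_num)]
      have : n * d ≤ n * (n - 1) := Nat.mul_le_mul_left _ hdn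
      omega
    have := Nat.choose_pos hMN
    rcases Nat.eq_zero_or_pos (regularGraphs n d).card with h0 | h0
    · rw [h0] at henum; omega
    · exact h0
  have hposr : (0 : ℝ) < (regularGraphs n d).card := by exact_mod_cast hpos
  unfold regPr
  rw [le_div_iff₀ hposr]
  have hcover : regularGraphs n d ⊆ ((regularGraphs n d).filter (fun G =>
      specNorm (Matrix.of fun i j : Fin n =>
              if i = j then 0 else char ((d : ℝ) / n) G s(i, j))
            ≤ 1000 * Real.sqrt n * Real.log n ^ (2 : ℝ))) ∪
      ((regularGraphs n d).filter (fun G => ∃ S T : Finset (Fin n),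
      (20 * Real.log n + 1) * Real.sqrt (d * S.card * T.card) <
        |eST S T G - d / n * eST S T (allE n)|)) := by
    intro G hG
    rw [Finset.mem_union, Finset.mem_filter, Finset.mem_filter]
    by_cases hb : ∃ S T : Finset (Fin n),
      (20 * Real.log n + 1) * Real.sqrt (d * S.card * T.card) <
        |eST S T G - d / n * eST S T (allE n)|
    · right; exact ⟨hG, hb⟩
    · left
      push Not at hb
      refine ⟨hG, ?_⟩
      rw [Real.rpow_two]
      exact hgood G hG hb
  have hcard := (Finset.card_le_card hcover).trans (Finset.card_union_le _ _)
  have hcardr := (Nat.cast_le (α := ℝ)).2 hcard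
  rw [Nat.cast_add] at hcardr
  have hsmall : 9 / (n : ℝ) ^ 2 ≤ ε := by
    rw [div_le_iff₀ (by positivity)]
    rw [div_le_iff₀ hε] at h3
    nlinarith
  have := mul_le_mul_of_nonneg_right hsmall hposr.le
  linarith
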